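/- Every planar graph G with maximum degree Δ(G) has an acyclic edge coloring using at most Δ(G)+10 colors. -/

import Mathlib

open SimpleGraph Finset

universe u

variable {V : Type u}

/-- A proper edge coloring with `k` colors: distinct edges sharing a vertex get
different colors. -/
def ProperEC (G : SimpleGraph V) {k : ℕ} (φ : Sym2 V → Fin k) : Prop :=
  ∀ e₁ ∈ G.edgeSet, ∀ e₂ ∈ G.edgeSet, e₁ ≠ e₂ → (∃ x, x ∈ e₁ ∧ x ∈ e₂) → φ e₁ ≠ φ e₂

/-- An acyclic edge coloring: proper, and no cycle of `G` uses only two colors. -/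
def AcyclicEC (G : SimpleGraph V) {k : ℕ} (φ : Sym2 V → Fin k) : Prop :=
  ProperEC G φ ∧
    ∀ (v : V) (w : G.Walk v v), w.IsCycle → 2 < (w.edges.map φ).toFinset.card

/-- `G` has an acyclic edge coloring with `k` colors, i.e. `χ'_a(G) ≤ k`. -/
def HasAEC (G : SimpleGraph V) (k : ℕ) : Prop :=
  ∃ φ : Sym2 V → Fin k, AcyclicEC G φ

/-- `G` is acyclically edge `k`-critical: `χ'_a(G) > k` but every proper subgraph
admits an acyclic edge `k`-coloring. -/
def AcyclicallyEdgeCritical (G : SimpleGraph V) (k : ℕ) : Prop :=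
  ¬ HasAEC G k ∧ ∀ H : SimpleGraph V, H ≤ G → H ≠ G → HasAEC H k

/-- `C_φ(v)`: the set of colors appearing on edges incident with `v`. -/
def Cset (G : SimpleGraph V) {k : ℕ} (φ : Sym2 V → Fin k) (v : V) : Set (Fin k) :=
  {c | ∃ u, G.Adj v u ∧ φ s(v, u) = c}

/-- `H` is a minor of `G`: disjoint connected branch sets realizing the edges of `H`. -/
def HasMinor {W : Type*} (G : SimpleGraph V) (H : SimpleGraph W) : Prop :=
  ∃ f : W → Set V,
    (∀ w, (f w).Nonempty ∧ (G.induce (f w)).Connected) ∧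
    (∀ w₁ w₂, w₁ ≠ w₂ → Disjoint (f w₁) (f w₂)) ∧
    ∀ w₁ w₂, H.Adj w₁ w₂ → ∃ v₁ ∈ f w₁, ∃ v₂ ∈ f w₂, G.Adj v₁ v₂

/-- Planarity via Wagner's theorem: no `K₅` minor and no `K₃,₃` minor. -/
def IsPlanar (G : SimpleGraph V) : Prop :=
  ¬ HasMinor G (completeGraph (Fin 5)) ∧
    ¬ HasMinor G (completeBipartiteGraph (Fin 3) (Fin 3))

section Conflict

open scoped Classical

/-- An abstraction of the two-coloured alternating paths between the neighbours of a deleted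
vertex: `used v` is the set of colours already present at `v`, and `conflict v c w d` says that
giving `v` the colour `c` and `w` the colour `d` closes a two-coloured cycle. -/
structure ConflictSystem (V α : Type*) where
  used : V → Finset α
  conflict : V → α → V → α → Prop
  symm : ∀ {v c w d}, conflict v c w d → conflict w d v c
  mem_used : ∀ {v c w d}, conflict v c w d → c ∈ used w
  unique : ∀ {v c w w' d}, conflict v c w d → conflict v c w' d → w = w'

namespace ConflictSystem

variable {α : Type*} {P : ConflictSystem V α}

/-- The colours `c` at `v` and `d` at `w` are compatible. -/
def Ok (P : ConflictSystem V α) (v : V) (c : α) (w : V) (d : α) : Prop :=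
  c ≠ d ∧ ¬ P.conflict v c w d

/-- The neighbours in `N` can be coloured in a compatible way. -/
def Extendable (P : ConflictSystem V α) (N : Set V) : Prop :=
  ∃ col : V → α, (∀ v ∈ N, col v ∉ P.used v) ∧
    ∀ v ∈ N, ∀ w ∈ N, v ≠ w → P.Ok v (col v) w (col w)

theorem Ok.symm {v w : V} {c d : α} (h : P.Ok v c w d) : P.Ok w d v c :=
  ⟨h.1.symm, fun h' => h.2 (P.symm h')⟩

theorem ok_of_left {v w : V} {c d : α} (h : c ≠ d) (hc : c ∉ P.used w) : P.Ok v c w d :=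
  ⟨h, fun h' => hc (P.mem_used h')⟩

theorem ok_of_right {v w : V} {c d : α} (h : c ≠ d) (hd : d ∉ P.used v) : P.Ok v c w d :=
  (ok_of_left h.symm hd).symm

/-- If `v` coloured `c` conflicts with `u`, it does not conflict with any other vertex. -/
theorem ok_of_conflict {v w u : V} {c d : α} (h : c ≠ d) (hc : P.conflict v c u d)
    (hne : u ≠ w) : P.Ok v c w d :=
  ⟨h, fun h' => hne (P.unique hc h')⟩

theorem exists_avoid [Fintype α] (T : Finset α) (l : List α)
    (h : T.card + l.length < Fintype.card α) : ∃ c, c ∉ T ∧ ∀ d ∈ l, c ≠ d := by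
  have : (T ∪ l.toFinset).card < (Finset.univ : Finset α).card :=
    (Finset.card_union_le _ _).trans_lt
      ((Nat.add_le_add_left l.toFinset_card_le _).trans_lt (by simpa using h))
  obtain ⟨c, -, hc⟩ := Finset.exists_mem_notMem_of_card_lt_card this
  simp only [Finset.mem_union, List.mem_toFinset, not_or] at hc
  exact ⟨c, hc.1, fun d hd e => hc.2 (e ▸ hd)⟩

theorem exists_avoid₂ [Fintype α] (S T : Finset α) (l : List α)
    (h : S.card + T.card + l.length < Fintype.card α) :
    ∃ c, c ∉ S ∧ c ∉ T ∧ ∀ d ∈ l, c ≠ d := by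
  obtain ⟨c, hc, hl⟩ := exists_avoid (S ∪ T) l (by
    have := Finset.card_union_le S T; omega)
  simp only [Finset.mem_union, not_or] at hc
  exact ⟨c, hc.1, hc.2, hl⟩

/-- A compatible assignment given as a list of pairs. -/
theorem extendable_of_list [Nonempty α] {N : Set V} (l : List (V × α))
    (hN : ∀ v ∈ N, v ∈ l.map Prod.fst) (hu : ∀ p ∈ l, p.2 ∉ P.used p.1)
    (hp : l.Pairwise fun p q => P.Ok p.1 p.2 q.1 q.2) : P.Extendable N := by
  have hl : ∀ v ∈ N, ∃ c, (v, c) ∈ l := by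
    intro v hv
    obtain ⟨p, hp, rfl⟩ := List.mem_map.1 (hN v hv)
    exact ⟨p.2, hp⟩
  choose! col hcol using hl
  refine ⟨col, fun v hv => hu _ (hcol v hv), fun v hv w hw hvw => ?_⟩
  have : Std.Symm fun p q : V × α => P.Ok p.1 p.2 q.1 q.2 := ⟨fun _ _ => Ok.symm⟩
  exact hp.forall (hcol v hv) (hcol w hw) fun e => hvw (congrArg Prod.fst e)

theorem extend_one [Fintype α] {z₁ z₂ y : V} {c₁ c₂ : α} (h₁₂ : z₁ ≠ z₂) (h₁ : z₁ ≠ y)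
    (hc₁ : c₁ ∉ P.used z₁) (hc₂ : c₂ ∉ P.used z₂) (hc : P.Ok z₁ c₁ z₂ c₂)
    (hz₁ : (P.used z₁).card + 11 ≤ Fintype.card α) (hz₂ : (P.used z₂).card + 11 ≤ Fintype.card α)
    (hy : (P.used y).card ≤ 10) (hα : 13 ≤ Fintype.card α) :
    P.Extendable {z₁, z₂, y} := by
  have : Nonempty α := ⟨c₁⟩
  have key : ∀ a b p : α, a ∉ P.used z₁ → b ∉ P.used z₂ → p ∉ P.used y → P.Ok z₁ a z₂ b →
      P.Ok z₁ a y p → P.Ok z₂ b y p → P.Extendable {z₁, z₂, y} := by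
    intro a b p ha hb hp hab hap hbp
    refine extendable_of_list [(z₁, a), (z₂, b), (y, p)] ?_ ?_ ?_ <;> simp [*]
  have hcompl : ∀ z, (P.used z)ᶜ.card = Fintype.card α - (P.used z).card :=
    fun z => Finset.card_compl _
  by_cases hab : ∃ a b, a ∉ P.used z₁ ∧ a ∉ P.used y ∧ b ∉ P.used z₂ ∧ b ∉ P.used y ∧ a ≠ b
  · obtain ⟨a, b, ha, hay, hb, hby, hab⟩ := hab
    obtain ⟨p, hp, hpl⟩ := exists_avoid (P.used y) [a, b] (by simp; omega)
    simp only [List.mem_cons, List.not_mem_nil, or_false, forall_eq_or_imp, forall_eq] at hpl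
    by_cases hok : a ∉ P.used z₂ ∨ b ∉ P.used z₁
    · exact key a b p ha hb hp (hok.elim (ok_of_left hab) (ok_of_right hab))
        (ok_of_left hpl.1.symm hay) (ok_of_left hpl.2.symm hby)
    push Not at hok
    have hac : a ≠ c₂ := fun e => hc₂ (e ▸ hok.1)
    by_cases hcf : P.conflict z₁ a z₂ c₂
    · exact key c₁ c₂ a hc₁ hc₂ hay hc
        (ok_of_right (fun e => hc.2 (e ▸ hcf)) ha)
        (ok_of_conflict hac.symm (P.symm hcf) h₁)
    · by_cases hcb : c₂ = b
      · subst hcb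
        exact key a c₂ p ha hb hp ⟨hab, hcf⟩
          (ok_of_left hpl.1.symm hay) (ok_of_left hpl.2.symm hby)
      · exact key a c₂ b ha hc₂ hby ⟨hac, hcf⟩ (ok_of_left hab hay) (ok_of_right hcb hb)
  · push Not at hab
    obtain ⟨a, ha, hay, -⟩ := exists_avoid₂ (P.used z₁) (P.used y) [] (by simp; omega)
    obtain ⟨b, hb, hby, -⟩ := exists_avoid₂ (P.used z₂) (P.used y) [] (by simp; omega)
    obtain rfl := hab a b ha hay hb hby
    obtain ⟨p, hp, hpl⟩ := exists_avoid (P.used y) [a] (by simp; omega)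
    simp only [List.mem_cons, List.not_mem_nil, or_false, forall_eq] at hpl
    have hE₁ : (P.used z₁)ᶜ.erase a = P.used y := by
      refine Finset.eq_of_subset_of_card_le (fun c hc => ?_) ?_
      · simp only [Finset.mem_erase, Finset.mem_compl] at hc
        by_contra h
        exact hc.1 (hab c a hc.2 h hb hby)
      · rw [Finset.card_erase_of_mem (by simpa), hcompl]; omega
    have hE₂ : (P.used z₂)ᶜ.erase a = P.used y := by
      refine Finset.eq_of_subset_of_card_le (fun c hc => ?_) ?_
      · simp only [Finset.mem_erase, Finset.mem_compl] at hc
        by_contra h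
        exact hc.1 (hab a c ha hay hc.2 h).symm
      · rw [Finset.card_erase_of_mem (by simpa), hcompl]; omega
    obtain ⟨g, hg⟩ : ((P.used z₁)ᶜ.erase a).Nonempty := by
      rw [← Finset.card_pos, Finset.card_erase_of_mem (by simpa), hcompl]; omega
    have hgy := hE₁ ▸ hg
    have hg₂ := hE₂ ▸ hgy
    simp only [Finset.mem_erase, Finset.mem_compl] at hg hg₂
    have hpg : p ≠ g := fun e => hp (e ▸ hgy)
    by_cases hcf : P.conflict y p z₁ g
    · exact key a g p ha hg₂.2 hp (ok_of_left hg.1.symm hb) (ok_of_left hpl.symm hay)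
        (ok_of_conflict hpg hcf h₁₂).symm
    · exact key g a p hg.2 hb hp (ok_of_right hg.1 ha) (Ok.symm ⟨hpg, hcf⟩)
        (ok_of_left hpl.symm hay)

/-- Two vertices whose only constraint besides each other is a vertex `z` coloured `h`. -/
theorem exists_pair [Fintype α] {z y₁ y₂ : V} {h : α} (Q : List α)
    (hy : y₁ ≠ y₂) (h₁ : (P.used z).card + (P.used y₁).card + Q.length + 1 < Fintype.card α)
    (h₂ : (P.used z).card + (P.used y₂).card + Q.length + 1 < Fintype.card α)
    (h₁₂ : (P.used y₁).card + (P.used y₂).card + Q.length + 2 < Fintype.card α) :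
    ∃ p q, p ∉ P.used y₁ ∧ q ∉ P.used y₂ ∧ (∀ d ∈ Q, p ≠ d) ∧ (∀ d ∈ Q, q ≠ d) ∧
      P.Ok z h y₁ p ∧ P.Ok z h y₂ q ∧ P.Ok y₁ p y₂ q := by
  have key : ∀ y₁ y₂ : V, (P.used z).card + (P.used y₂).card + Q.length + 1 < Fintype.card α →
      (P.used y₁).card + (P.used y₂).card + Q.length + 2 < Fintype.card α → h ∉ P.used y₁ →
      ∃ p q, p ∉ P.used y₁ ∧ q ∉ P.used y₂ ∧ (∀ d ∈ Q, p ≠ d) ∧ (∀ d ∈ Q, q ≠ d) ∧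
      P.Ok z h y₁ p ∧ P.Ok z h y₂ q ∧ P.Ok y₁ p y₂ q := by
    intro y₁ y₂ h₂ h₁₂ hhy
    obtain ⟨q, hqz, hqy, hq⟩ := exists_avoid₂ (P.used z) (P.used y₂) (h :: Q) (by simp; omega)
    obtain ⟨p, hp₁, hp₂, hp⟩ :=
      exists_avoid₂ (P.used y₁) (P.used y₂) (h :: q :: Q) (by simp; omega)
    simp only [List.mem_cons, forall_eq_or_imp] at hp hq
    exact ⟨p, q, hp₁, hqy, hp.2.2, hq.2, ok_of_left hp.1.symm hhy, ok_of_right hq.1.symm hqz,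
      ok_of_left hp.2.1 hp₂⟩
  by_cases hhy₁ : h ∉ P.used y₁
  · exact key y₁ y₂ h₂ h₁₂ hhy₁
  by_cases hhy₂ : h ∉ P.used y₂
  · obtain ⟨p, q, h1, h2, h3, h4, h5, h6, h7⟩ := key y₂ y₁ h₁ (by omega) hhy₂
    exact ⟨q, p, h2, h1, h4, h3, h6, h5, h7.symm⟩
  push Not at hhy₁ hhy₂
  obtain ⟨o, ho₁, ho₂, hoQ⟩ := exists_avoid₂ (P.used y₁) (P.used y₂) Q (by omega)
  have hho : h ≠ o := fun e => ho₁ (e ▸ hhy₁)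
  by_cases hcf : P.conflict z h y₁ o
  · obtain ⟨q, hqz, hqy, hq⟩ := exists_avoid₂ (P.used z) (P.used y₁) (o :: Q) (by simp; omega)
    simp only [List.mem_cons, forall_eq_or_imp] at hq
    exact ⟨q, o, hqy, ho₂, hq.2, hoQ, ok_of_right (fun e => hqy (e ▸ hhy₁)) hqz,
      ok_of_conflict hho hcf hy, ok_of_right hq.1 ho₁⟩
  · obtain ⟨q, hqz, hqy, hq⟩ := exists_avoid₂ (P.used z) (P.used y₂) (o :: Q) (by simp; omega)
    simp only [List.mem_cons, forall_eq_or_imp] at hq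
    exact ⟨o, q, ho₁, hqy, hoQ, hq.2, ⟨hho, hcf⟩, ok_of_right (fun e => hqy (e ▸ hhy₂)) hqz,
      ok_of_left hq.1.symm ho₂⟩

/-- The last vertex `y` is coloured, possibly recolouring `z₁`, when all the colours in `Q`
already placed elsewhere would conflict at `z₁` with the colour of `z₂`. -/
theorem exists_recolor [Fintype α] {z₁ z₂ y : V} {c₁ c₂ : α} (Q : List α) (hy : z₁ ≠ y)
    (hc₁ : c₁ ∉ P.used z₁) (hc₂₁ : c₂ ∈ P.used z₁) (hc : P.Ok z₁ c₁ z₂ c₂)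
    (hQ : ∀ q ∈ Q, P.conflict z₁ q z₂ c₂)
    (h₂ : (P.used z₂).card + (P.used y).card + 2 < Fintype.card α)
    (h₁ : (P.used z₁).card + (P.used y).card + Q.length + 1 < Fintype.card α) :
    ∃ e p, e ∉ P.used z₁ ∧ p ∉ P.used y ∧ P.Ok z₁ e z₂ c₂ ∧ P.Ok z₁ e y p ∧ P.Ok z₂ c₂ y p ∧
      (∀ q ∈ Q, p ≠ q) ∧ (∀ q ∈ Q, e ≠ q) := by
  have hQ₂ : ∀ q ∈ Q, q ∈ P.used z₂ := fun q hq => P.mem_used (hQ q hq)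
  have hcQ : ∀ q ∈ Q, c₁ ≠ q := fun q hq e => hc.2 (e ▸ hQ q hq)
  by_cases hy₁ : c₁ ∉ P.used y
  · obtain ⟨p, hp₂, hp, hpl⟩ := exists_avoid₂ (P.used z₂) (P.used y) [c₁, c₂] (by simp; omega)
    simp only [List.mem_cons, List.not_mem_nil, or_false, forall_eq_or_imp, forall_eq] at hpl
    exact ⟨c₁, p, hc₁, hp, hc, ok_of_left hpl.1.symm hy₁, ok_of_right hpl.2.symm hp₂,
      fun q hq e => hp₂ (e ▸ hQ₂ q hq), hcQ⟩
  by_cases hy₂ : c₂ ∉ P.used y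
  · obtain ⟨p, hp₁, hp, hpl⟩ := exists_avoid₂ (P.used z₁) (P.used y) (c₁ :: Q) (by simp; omega)
    simp only [List.mem_cons, forall_eq_or_imp] at hpl
    have hpc : c₂ ≠ p := fun e => hp₁ (e ▸ hc₂₁)
    exact ⟨c₁, p, hc₁, hp, hc, ok_of_right hpl.1.symm hp₁, ok_of_left hpc hy₂, hpl.2, hcQ⟩
  push Not at hy₁ hy₂
  obtain ⟨a, ha₁, hay, haQ⟩ := exists_avoid₂ (P.used z₁) (P.used y) Q (by omega)
  have hac₂ : a ≠ c₂ := fun e => hay (e ▸ hy₂)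
  have hac₁ : c₁ ≠ a := fun e => hay (e ▸ hy₁)
  by_cases hcf : P.conflict z₁ a z₂ c₂
  · exact ⟨c₁, a, hc₁, hay, hc, ok_of_right hac₁ ha₁, ok_of_conflict hac₂.symm (P.symm hcf) hy,
      haQ, hcQ⟩
  · obtain ⟨p, hp₂, hp, hpl⟩ := exists_avoid₂ (P.used z₂) (P.used y) [a, c₂] (by simp; omega)
    simp only [List.mem_cons, List.not_mem_nil, or_false, forall_eq_or_imp, forall_eq] at hpl
    exact ⟨a, p, ha₁, hp, ⟨hac₂, hcf⟩, ok_of_left hpl.1.symm hay, ok_of_right hpl.2.symm hp₂,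
      fun q hq e => hp₂ (e ▸ hQ₂ q hq), haQ⟩

theorem extend_two [Fintype α] {z₁ z₂ y₁ y₂ : V} {c₁ c₂ : α} (h₁₂ : z₁ ≠ z₂) (hy₁₂ : y₁ ≠ y₂)
    (h₁₁ : z₁ ≠ y₁) (h₁₂' : z₁ ≠ y₂) (h₂₁ : z₂ ≠ y₁) (h₂₂ : z₂ ≠ y₂)
    (hc₁ : c₁ ∉ P.used z₁) (hc₂ : c₂ ∉ P.used z₂) (hc : P.Ok z₁ c₁ z₂ c₂)
    (hz₁ : (P.used z₁).card + 11 ≤ Fintype.card α) (hz₂ : (P.used z₂).card + 11 ≤ Fintype.card α)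
    (hY₁ : (P.used y₁).card ≤ 8) (hY₂ : (P.used y₂).card ≤ 8)
    (hY : (P.used y₁).card + (P.used y₂).card ≤ 13)
    (hα : (P.used y₁).card + (P.used y₂).card + 5 ≤ Fintype.card α) :
    P.Extendable {z₁, z₂, y₁, y₂} := by
  have : Nonempty α := ⟨c₁⟩
  have fresh : ∀ {z₁ z₂ : V} {c₁ c₂ a : α}, z₁ ≠ y₁ → z₁ ≠ y₂ → z₁ ≠ z₂ →
      c₁ ∉ P.used z₁ → c₂ ∉ P.used z₂ → P.Ok z₁ c₁ z₂ c₂ →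
      (P.used z₁).card + 11 ≤ Fintype.card α → (P.used z₂).card + 11 ≤ Fintype.card α →
      a ∉ P.used z₁ → a ∉ P.used y₁ → a ∉ P.used y₂ → P.Extendable {z₁, z₂, y₁, y₂} := by
    intro z₁ z₂ c₁ c₂ a h₁₁ h₁₂' h₁₂ hc₁ hc₂ hc hz₁ hz₂ ha ha₁ ha₂
    by_cases hac : a = c₂
    · subst hac
      obtain ⟨p, q, hp, hq, hpQ, hqQ, hp₁, hq₁, hpq⟩ :=
        P.exists_pair (z := z₁) (h := c₁) [a] hy₁₂ (by simp; omega) (by simp; omega)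
          (by simp; omega)
      simp only [List.mem_cons, List.not_mem_nil, or_false, forall_eq] at hpQ hqQ
      refine extendable_of_list [(z₁, c₁), (z₂, a), (y₁, p), (y₂, q)] (by simp) (by simp [*]) ?_
      have := ok_of_left (P := P) (v := z₂) hpQ.symm ha₁
      have := ok_of_left (P := P) (v := z₂) hqQ.symm ha₂
      simp [*]
    by_cases hcf : P.conflict z₁ a z₂ c₂
    · obtain ⟨e, p, he, hp, h1, h2, h3, hpQ, heQ⟩ := exists_recolor (y := y₂) [a] h₁₂' hc₁
        (P.mem_used (P.symm hcf)) hc (by simpa) (by omega) (by simp; omega)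
      simp only [List.mem_cons, List.not_mem_nil, or_false, forall_eq] at hpQ heQ
      refine extendable_of_list [(z₁, e), (z₂, c₂), (y₁, a), (y₂, p)] (by simp) (by simp [*]) ?_
      have := ok_of_right (P := P) (w := y₁) heQ ha
      have := ok_of_conflict (Ne.symm hac) (P.symm hcf) h₁₁
      have := ok_of_left (P := P) (v := y₁) hpQ.symm ha₂
      simp [*]
    · obtain ⟨p, q, hp, hq, hpQ, hqQ, hp₁, hq₁, hpq⟩ :=
        P.exists_pair (z := z₂) (h := c₂) [a] hy₁₂ (by simp; omega) (by simp; omega)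
          (by simp; omega)
      simp only [List.mem_cons, List.not_mem_nil, or_false, forall_eq] at hpQ hqQ
      refine extendable_of_list [(z₁, a), (z₂, c₂), (y₁, p), (y₂, q)] (by simp) (by simp [*]) ?_
      have : P.Ok z₁ a z₂ c₂ := ⟨hac, hcf⟩
      have := ok_of_left (P := P) (v := z₁) hpQ.symm ha₁
      have := ok_of_left (P := P) (v := z₁) hqQ.symm ha₂
      simp [*]
  by_cases hA₁ : ∃ a, a ∉ P.used z₁ ∧ a ∉ P.used y₁ ∧ a ∉ P.used y₂
  · obtain ⟨a, ha, ha₁, ha₂⟩ := hA₁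
    exact fresh h₁₁ h₁₂' h₁₂ hc₁ hc₂ hc hz₁ hz₂ ha ha₁ ha₂
  by_cases hA₂ : ∃ a, a ∉ P.used z₂ ∧ a ∉ P.used y₁ ∧ a ∉ P.used y₂
  · obtain ⟨a, ha, ha₁, ha₂⟩ := hA₂
    rw [Set.insert_comm]
    exact fresh h₂₁ h₂₂ h₁₂.symm hc₂ hc₁ hc.symm hz₂ hz₁ ha ha₁ ha₂
  obtain ⟨o, ho₁, ho₂, -⟩ := exists_avoid₂ (P.used y₁) (P.used y₂) [] (by simp; omega)
  have place : ∀ {z z' y y' : V} {g : α}, y ≠ z → z ≠ z' → y ≠ y' →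
      g ∉ P.used z → g ∉ P.used z' → g ∈ P.used y → g ∉ P.used y' → o ∉ P.used y →
      o ∉ P.used y' → ¬ P.conflict y o z g → (P.used z').card + 11 ≤ Fintype.card α →
      (P.used y).card ≤ 8 → (P.used y').card ≤ 8 → o ∈ P.used z' →
      P.Extendable {z, z', y, y'} := by
    intro z z' y y' g hyz hzz hyy hgz hgz' hgy hgy' hoy hoy' hcf hz' hy hy' hoz
    obtain ⟨h, hh, hhy, -⟩ := exists_avoid₂ (P.used z') (P.used y) [] (by simp; omega)
    obtain ⟨p, hp, hpy, hpl⟩ := exists_avoid₂ (P.used z') (P.used y') [h, g] (by simp; omega)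
    simp only [List.mem_cons, List.not_mem_nil, or_false, forall_eq_or_imp, forall_eq] at hpl
    refine extendable_of_list [(z, g), (z', h), (y, o), (y', p)] (by simp) (by simp [*]) ?_
    have hgh : g ≠ h := fun e => hhy (e ▸ hgy)
    have hgo : g ≠ o := fun e => hoy (e ▸ hgy)
    have hho : h ≠ o := fun e => hh (e ▸ hoz)
    have hop : o ≠ p := fun e => hp (e ▸ hoz)
    have := ok_of_left (P := P) (v := z) hgh hgz'
    have : P.Ok z g y o := Ok.symm ⟨hgo.symm, hcf⟩
    have := ok_of_left (P := P) (v := z) hpl.2.symm hgy'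
    have := ok_of_left (P := P) (v := z') hho hhy
    have := ok_of_right (P := P) (w := y') hpl.1.symm hp
    have := ok_of_left (P := P) (v := y) hop hoy'
    simp [*]
  push Not at hA₁ hA₂
  have ho : ∀ {z}, (∀ a ∉ P.used z, a ∉ P.used y₁ → a ∈ P.used y₂) → o ∈ P.used z :=
    fun h => by_contra fun h' => ho₂ (h o h' ho₁)
  have side : ∀ {y y' : V} {g : α}, z₁ ≠ y → z₂ ≠ y → y ≠ y' →
      g ∉ P.used z₁ → g ∉ P.used z₂ → g ∈ P.used y → g ∉ P.used y' → o ∉ P.used y →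
      o ∉ P.used y' → (P.used y).card ≤ 8 → (P.used y').card ≤ 8 →
      P.Extendable {z₁, z₂, y, y'} := by
    intro y y' g hy₁ hy₂ hyy hg₁ hg₂ hgy hgy' hoy hoy' hy hy'
    by_cases hcf : P.conflict y o z₁ g
    · rw [Set.insert_comm]
      exact place hy₂.symm h₁₂.symm hyy hg₂ hg₁ hgy hgy' hoy hoy'
        (fun h => h₁₂ (P.unique hcf h)) hz₁ hy hy' (ho hA₁)
    · exact place hy₁.symm h₁₂ hyy hg₁ hg₂ hgy hgy' hoy hoy' hcf hz₂ hy hy' (ho hA₂)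
  obtain ⟨g, hg₁, hg₂, hg⟩ : ∃ g, g ∉ P.used z₁ ∧ g ∉ P.used z₂ ∧ g ∉ P.used y₁ ∩ P.used y₂ := by
    by_contra! hne
    have hs₁ : (P.used z₁)ᶜ ⊆ P.used y₁ ∪ P.used y₂ := fun a ha => by
      have := hA₁ a (by simpa using ha)
      simp only [Finset.mem_union]; tauto
    have hs₂ : (P.used z₂)ᶜ ⊆ P.used y₁ ∪ P.used y₂ := fun a ha => by
      have := hA₂ a (by simpa using ha)
      simp only [Finset.mem_union]; tauto
    have hs₃ : (P.used z₁)ᶜ ∩ (P.used z₂)ᶜ ⊆ P.used y₁ ∩ P.used y₂ := fun a ha => by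
      simp only [Finset.mem_inter, Finset.mem_compl] at ha
      exact hne a ha.1 ha.2
    have e₁ := Finset.card_le_card (Finset.union_subset hs₁ hs₂)
    have e₂ := Finset.card_le_card hs₃
    have e₃ := Finset.card_union_add_card_inter (P.used z₁)ᶜ (P.used z₂)ᶜ
    have e₄ := Finset.card_union_add_card_inter (P.used y₁) (P.used y₂)
    rw [Finset.card_compl, Finset.card_compl] at e₃
    omega
  by_cases hgy : g ∈ P.used y₁
  · have hgy' : g ∉ P.used y₂ := fun h => hg (Finset.mem_inter.2 ⟨hgy, h⟩)
    exact side h₁₁ h₂₁ hy₁₂ hg₁ hg₂ hgy hgy' ho₁ ho₂ hY₁ hY₂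
  · rw [Set.pair_comm y₁ y₂]
    exact side h₁₂' h₂₂ hy₁₂.symm hg₁ hg₂ (hA₁ g hg₁ hgy) hgy ho₂ ho₁ hY₂ hY₁

/-- Three vertices whose only constraint besides each other is a vertex `z` coloured `h`. -/
theorem exists_triple [Fintype α] {z y₁ y₂ y₃ : V} {h : α} (a : α)
    (h₁₂ : y₁ ≠ y₂) (h₁₃ : y₁ ≠ y₃) (h₂₃ : y₂ ≠ y₃)
    (hz : (P.used z).card + 11 ≤ Fintype.card α)
    (hY₁ : (P.used y₁).card ≤ 6) (hY₂ : (P.used y₂).card ≤ 6) (hY₃ : (P.used y₃).card ≤ 6)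
    (hα : (P.used y₁).card + (P.used y₂).card + (P.used y₃).card < Fintype.card α)
    (hα₁₂ : (P.used y₁).card + (P.used y₂).card + 6 ≤ Fintype.card α)
    (hα₁₃ : (P.used y₁).card + (P.used y₃).card + 6 ≤ Fintype.card α)
    (hα₂₃ : (P.used y₂).card + (P.used y₃).card + 6 ≤ Fintype.card α) :
    ∃ p₁ p₂ p₃, p₁ ∉ P.used y₁ ∧ p₂ ∉ P.used y₂ ∧ p₃ ∉ P.used y₃ ∧ p₁ ≠ a ∧ p₂ ≠ a ∧ p₃ ≠ a ∧
      P.Ok z h y₁ p₁ ∧ P.Ok z h y₂ p₂ ∧ P.Ok z h y₃ p₃ ∧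
      P.Ok y₁ p₁ y₂ p₂ ∧ P.Ok y₁ p₁ y₃ p₃ ∧ P.Ok y₂ p₂ y₃ p₃ := by
  by_cases ho : ∃ o, o ∉ P.used y₁ ∧ o ∉ P.used y₂ ∧ o ∉ P.used y₃ ∧ o ≠ a ∧ h ≠ o
  · obtain ⟨o, ho₁, ho₂, ho₃, hoa, hho⟩ := ho
    by_cases hcf : P.conflict z h y₁ o
    · obtain ⟨p, q, hp, hq, hpQ, hqQ, hp₁, hq₁, hpq⟩ :=
        P.exists_pair (z := z) (h := h) [a, o] h₁₃ (by simp; omega) (by simp; omega)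
          (by simp; omega)
      simp only [List.mem_cons, List.not_mem_nil, or_false, forall_eq_or_imp, forall_eq]
        at hpQ hqQ
      exact ⟨p, o, q, hp, ho₂, hq, hpQ.1, hoa, hqQ.1, hp₁, ok_of_conflict hho hcf h₁₂, hq₁,
        ok_of_right hpQ.2 ho₁, hpq, ok_of_left hqQ.2.symm ho₃⟩
    · obtain ⟨p, q, hp, hq, hpQ, hqQ, hp₁, hq₁, hpq⟩ :=
        P.exists_pair (z := z) (h := h) [a, o] h₂₃ (by simp; omega) (by simp; omega)
          (by simp; omega)
      simp only [List.mem_cons, List.not_mem_nil, or_false, forall_eq_or_imp, forall_eq]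
        at hpQ hqQ
      exact ⟨o, p, q, ho₁, hp, hq, hoa, hpQ.1, hqQ.1, ⟨hho, hcf⟩, hp₁, hq₁,
        ok_of_left hpQ.2.symm ho₂, ok_of_left hqQ.2.symm ho₃, hpq⟩
  have hU : Fintype.card α ≤ (P.used y₁ ∪ P.used y₂ ∪ P.used y₃).card + 2 := by
    by_contra! hlt
    obtain ⟨o, hoU, hol⟩ := exists_avoid (P.used y₁ ∪ P.used y₂ ∪ P.used y₃) [a, h]
      (by simpa using hlt)
    simp only [Finset.mem_union, not_or, List.mem_cons, List.not_mem_nil, or_false,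
      forall_eq_or_imp, forall_eq] at hoU hol
    exact ho ⟨o, hoU.1.1, hoU.1.2, hoU.2, hol.1, hol.2.symm⟩
  have hU' : h ∈ P.used y₁ ∪ P.used y₂ ∪ P.used y₃ →
      Fintype.card α ≤ (P.used y₁ ∪ P.used y₂ ∪ P.used y₃).card + 1 := by
    intro hh
    by_contra! hlt
    obtain ⟨o, hoU, hol⟩ := exists_avoid (P.used y₁ ∪ P.used y₂ ∪ P.used y₃) [a]
      (by simpa using hlt)
    have hho : h ≠ o := fun e => hoU (e ▸ hh)
    simp only [Finset.mem_union, not_or, List.mem_cons, List.not_mem_nil, or_false,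
      forall_eq] at hoU hol
    exact ho ⟨o, hoU.1.1, hoU.1.2, hoU.2, hol, hho⟩
  have c₁ := Finset.card_union_add_card_inter (P.used y₁ ∪ P.used y₂) (P.used y₃)
  have c₂ := Finset.card_union_add_card_inter (P.used y₁) (P.used y₂)
  have i₁₃ := Finset.card_le_card (Finset.inter_subset_inter_right (u := P.used y₃)
    (Finset.subset_union_left (s₁ := P.used y₁) (s₂ := P.used y₂)))
  have i₂₃ := Finset.card_le_card (Finset.inter_subset_inter_right (u := P.used y₃)
    (Finset.subset_union_right (s₁ := P.used y₁) (s₂ := P.used y₂)))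
  have ordered : ∀ {y y' y'' : V} {p : α}, (P.used y).card + (P.used y'').card + 6 ≤
      Fintype.card α → (P.used y'').card + (P.used y').card + 6 ≤ Fintype.card α →
      h ∉ P.used y → h ∉ P.used y'' → p ∉ P.used z → p ∉ P.used y' → p ≠ a → p ≠ h →
      p ∉ P.used y → ∃ q r, q ∉ P.used y ∧ r ∉ P.used y'' ∧ q ≠ a ∧ r ≠ a ∧
      P.Ok z h y' p ∧ P.Ok z h y q ∧ P.Ok z h y'' r ∧ P.Ok y' p y q ∧ P.Ok y' p y'' r ∧
      P.Ok y q y'' r := by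
    intro y y' y'' p hs hs' hy hy'' hpz hpy' hpa hph hpy
    obtain ⟨q, hqy, hqy'', hq⟩ :=
      exists_avoid₂ (P.used y) (P.used y'') [a, h, p] (by simp; omega)
    obtain ⟨r, hry, hry'', hr⟩ :=
      exists_avoid₂ (P.used y'') (P.used y') [a, h, p, q] (by simp; omega)
    simp only [List.mem_cons, List.not_mem_nil, or_false, forall_eq_or_imp, forall_eq] at hq hr
    exact ⟨q, r, hqy, hry, hq.1, hr.1, ok_of_right hph.symm hpz, ok_of_left hq.2.1.symm hy,
      ok_of_left hr.2.1.symm hy'', ok_of_left hq.2.2.symm hpy, ok_of_right hr.2.2.1.symm hry'',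
      ok_of_left hr.2.2.2.symm hqy''⟩
  have split : ∀ {y y' y'' : V}, (P.used y).card + (P.used y'').card + 6 ≤ Fintype.card α →
      (P.used y'').card + (P.used y').card + 6 ≤ Fintype.card α →
      (P.used y).card + (P.used y').card + 6 ≤ Fintype.card α →
      h ∉ P.used y → h ∉ P.used y'' → (P.used y ∩ P.used y'').card ≤ 1 →
      (P.used y').card ≤ 6 → ∃ p q r, p ∉ P.used y' ∧ p ≠ a ∧
      q ∉ P.used y ∧ r ∉ P.used y'' ∧ q ≠ a ∧ r ≠ a ∧
      P.Ok z h y' p ∧ P.Ok z h y q ∧ P.Ok z h y'' r ∧ P.Ok y' p y q ∧ P.Ok y' p y'' r ∧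
      P.Ok y q y'' r := by
    intro y y' y'' hs hs' hs'' hy hy'' hi hy'
    obtain ⟨p, hpz, hp, hpl⟩ := exists_avoid₂ (P.used z) (P.used y' ∪ (P.used y ∩ P.used y''))
      [a, h] (by
        have := Finset.card_union_le (P.used y') (P.used y ∩ P.used y'')
        simp; omega)
    simp only [Finset.mem_union, Finset.mem_inter, not_or, List.mem_cons, List.not_mem_nil,
      or_false, forall_eq_or_imp, forall_eq] at hp hpl
    by_cases hpy : p ∈ P.used y
    · obtain ⟨r, q, h1, h2, h3, h4, h5, h6, h7, h8, h9, h10⟩ :=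
        ordered (by omega) (by omega) hy'' hy hpz hp.1 hpl.1 hpl.2 fun h => hp.2 ⟨hpy, h⟩
      exact ⟨p, q, r, hp.1, hpl.1, h2, h1, h4, h3, h5, h7, h6, h9, h8, h10.symm⟩
    · obtain ⟨q, r, H⟩ := ordered hs hs' hy hy'' hpz hp.1 hpl.1 hpl.2 hpy
      exact ⟨p, q, r, hp.1, hpl.1, H⟩
  have pos : ∀ {y y' : V}, h ∈ P.used y → h ∈ P.used y' → 0 < (P.used y ∩ P.used y').card :=
    fun h h' => Finset.card_pos.2 ⟨_, Finset.mem_inter.2 ⟨h, h'⟩⟩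
  by_cases hy₁ : h ∈ P.used y₁
  · have hy₂ : h ∉ P.used y₂ := fun h' => by have := pos hy₁ h'; have := hU' (by simp [hy₁]); omega
    have hy₃ : h ∉ P.used y₃ := fun h' => by have := pos hy₁ h'; have := hU' (by simp [hy₁]); omega
    obtain ⟨p, q, r, h1, h2, h3, h4, h5, h6, h7, h8, h9, h10, h11, h12⟩ :=
      split (y' := y₁) hα₂₃ (by omega) (by omega) hy₂ hy₃ (by omega) hY₁
    exact ⟨p, q, r, h1, h3, h4, h2, h5, h6, h7, h8, h9, h10, h11, h12⟩
  by_cases hy₂ : h ∈ P.used y₂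
  · have hy₃ : h ∉ P.used y₃ := fun h' => by have := pos hy₂ h'; have := hU' (by simp [hy₂]); omega
    obtain ⟨p, q, r, h1, h2, h3, h4, h5, h6, h7, h8, h9, h10, h11, h12⟩ :=
      split (y' := y₂) hα₁₃ (by omega) (by omega) hy₁ hy₃ (by omega) hY₂
    exact ⟨q, p, r, h3, h1, h4, h5, h2, h6, h8, h7, h9, h10.symm, h12, h11⟩
  · obtain ⟨p, q, r, h1, h2, h3, h4, h5, h6, h7, h8, h9, h10, h11, h12⟩ :=
      split (y' := y₃) hα₁₂ (by omega) (by omega) hy₁ hy₂ (by omega) hY₃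
    exact ⟨q, r, p, h3, h4, h1, h5, h6, h2, h8, h9, h7, h12, h10.symm, h11.symm⟩

theorem extend_three_of_fresh [Fintype α] {z₁ z₂ y₁ y₂ y₃ : V} {c₁ c₂ a : α}
    (h₁₂ : y₁ ≠ y₂) (h₁₃ : y₁ ≠ y₃) (h₂₃ : y₂ ≠ y₃)
    (hzy₁ : z₁ ≠ y₁) (hzy₂ : z₁ ≠ y₂) (hzy₃ : z₁ ≠ y₃)
    (hc₁ : c₁ ∉ P.used z₁) (hc₂ : c₂ ∉ P.used z₂) (hc : P.Ok z₁ c₁ z₂ c₂)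
    (hz₁ : (P.used z₁).card + 11 ≤ Fintype.card α) (hz₂ : (P.used z₂).card + 11 ≤ Fintype.card α)
    (hY₁ : (P.used y₁).card ≤ 5) (hY₂ : (P.used y₂).card ≤ 5) (hY₃ : (P.used y₃).card ≤ 6)
    (hα : (P.used y₁).card + (P.used y₂).card + (P.used y₃).card < Fintype.card α)
    (hα₁₂ : (P.used y₁).card + (P.used y₂).card + 6 ≤ Fintype.card α)
    (hα₁₃ : (P.used y₁).card + (P.used y₃).card + 6 ≤ Fintype.card α)
    (hα₂₃ : (P.used y₂).card + (P.used y₃).card + 6 ≤ Fintype.card α)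
    (ha : a ∉ P.used z₁) (ha₁ : a ∉ P.used y₁) (ha₂ : a ∉ P.used y₂) (ha₃ : a ∉ P.used y₃) :
    P.Extendable {z₁, z₂, y₁, y₂, y₃} := by
  have : Nonempty α := ⟨a⟩
  by_cases hac : a = c₂
  · subst hac
    obtain ⟨p, q, r, hp, hq, hr, hpa, hqa, hra, h1, h2, h3, h4, h5, h6⟩ :=
      exists_triple (z := z₁) (h := c₁) a h₁₂ h₁₃ h₂₃ hz₁ (by omega) (by omega) hY₃ hα
        hα₁₂ hα₁₃ hα₂₃
    refine extendable_of_list [(z₁, c₁), (z₂, a), (y₁, p), (y₂, q), (y₃, r)] (by simp)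
      (by simp [*]) ?_
    have := ok_of_left (P := P) (v := z₂) hpa.symm ha₁
    have := ok_of_left (P := P) (v := z₂) hqa.symm ha₂
    have := ok_of_left (P := P) (v := z₂) hra.symm ha₃
    simp [*]
  by_cases hcf : P.conflict z₁ a z₂ c₂
  swap
  · obtain ⟨p, q, r, hp, hq, hr, hpa, hqa, hra, h1, h2, h3, h4, h5, h6⟩ :=
      exists_triple (z := z₂) (h := c₂) a h₁₂ h₁₃ h₂₃ hz₂ (by omega) (by omega) hY₃ hα
        hα₁₂ hα₁₃ hα₂₃
    refine extendable_of_list [(z₁, a), (z₂, c₂), (y₁, p), (y₂, q), (y₃, r)] (by simp)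
      (by simp [*]) ?_
    have : P.Ok z₁ a z₂ c₂ := ⟨hac, hcf⟩
    have := ok_of_left (P := P) (v := z₁) hpa.symm ha₁
    have := ok_of_left (P := P) (v := z₁) hqa.symm ha₂
    have := ok_of_left (P := P) (v := z₁) hra.symm ha₃
    simp [*]
  have hc₂₁ : c₂ ∈ P.used z₁ := P.mem_used (P.symm hcf)
  have hca : c₁ ≠ a := fun e => hc.2 (e ▸ hcf)
  have hzy₃' := ok_of_conflict (Ne.symm hac) (P.symm hcf) hzy₃
  by_cases hcY : c₂ ∉ P.used y₁ ∧ c₂ ∉ P.used y₂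
  · obtain ⟨p, q, hp, hq, hpQ, hqQ, hp₁, hq₁, hpq⟩ :=
      P.exists_pair (z := z₁) (h := c₁) [a, c₂] h₁₂ (by simp; omega) (by simp; omega)
        (by simp; omega)
    simp only [List.mem_cons, List.not_mem_nil, or_false, forall_eq_or_imp, forall_eq] at hpQ hqQ
    refine extendable_of_list [(z₁, c₁), (z₂, c₂), (y₁, p), (y₂, q), (y₃, a)] (by simp)
      (by simp [*]) ?_
    have := ok_of_right (P := P) (w := y₃) hca ha
    have := ok_of_left (P := P) (v := z₂) hpQ.2.symm hcY.1
    have := ok_of_left (P := P) (v := z₂) hqQ.2.symm hcY.2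
    have := ok_of_right (P := P) (w := y₃) hpQ.1 ha₁
    have := ok_of_right (P := P) (w := y₃) hqQ.1 ha₂
    simp [*]
  obtain ⟨a', ha', haY, haa⟩ := exists_avoid₂ (P.used z₁)
    ((P.used y₁ ∪ P.used y₂).erase c₂) [a] (by
      have hm : c₂ ∈ P.used y₁ ∪ P.used y₂ := by
        rw [Finset.mem_union]; tauto
      have := Finset.card_union_le (P.used y₁) (P.used y₂)
      have := Finset.card_erase_of_mem hm
      simp; omega)
  have hac' : a' ≠ c₂ := fun e => ha' (e ▸ hc₂₁)
  simp only [Finset.mem_erase, Finset.mem_union, not_and_or, not_or, List.mem_cons,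
    List.not_mem_nil, or_false, forall_eq, hac', not_true_eq_false, ne_eq, not_false_eq_true,
    false_or] at haY haa
  by_cases hcf' : P.conflict z₁ a' z₂ c₂
  · obtain ⟨e, p, he, hp, h1, h2, h3, hpQ, heQ⟩ := exists_recolor (y := y₂) [a, a'] hzy₂ hc₁ hc₂₁
      hc (by simp [*]) (by omega) (by simp; omega)
    simp only [List.mem_cons, List.not_mem_nil, or_false, forall_eq_or_imp, forall_eq] at hpQ heQ
    refine extendable_of_list [(z₁, e), (z₂, c₂), (y₁, a'), (y₂, p), (y₃, a)] (by simp)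
      (by simp [*]) ?_
    have := ok_of_right (P := P) (w := y₁) heQ.2 ha'
    have := ok_of_right (P := P) (w := y₃) heQ.1 ha
    have := ok_of_conflict (Ne.symm hac') (P.symm hcf') hzy₁
    have := ok_of_left (P := P) (v := y₁) hpQ.2.symm haY.2
    have := ok_of_right (P := P) (w := y₃) haa ha₁
    have := ok_of_right (P := P) (w := y₃) hpQ.1 ha₂
    simp [*]
  · obtain ⟨p, q, hp, hq, hpQ, hqQ, hp₁, hq₁, hpq⟩ :=
      P.exists_pair (z := z₂) (h := c₂) [a, a'] h₁₂ (by simp; omega) (by simp; omega)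
        (by simp; omega)
    simp only [List.mem_cons, List.not_mem_nil, or_false, forall_eq_or_imp, forall_eq] at hpQ hqQ
    refine extendable_of_list [(z₁, a'), (z₂, c₂), (y₁, p), (y₂, q), (y₃, a)] (by simp)
      (by simp [*]) ?_
    have : P.Ok z₁ a' z₂ c₂ := ⟨hac', hcf'⟩
    have := ok_of_right (P := P) (w := y₃) haa ha
    have := ok_of_left (P := P) (v := z₁) hpQ.2.symm haY.1
    have := ok_of_left (P := P) (v := z₁) hqQ.2.symm haY.2
    have := ok_of_right (P := P) (w := y₃) hpQ.1 ha₁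
    have := ok_of_right (P := P) (w := y₃) hqQ.1 ha₂
    simp [*]

theorem extend_three [Fintype α] {z₁ z₂ y₁ y₂ y₃ : V} {c₁ c₂ : α} (hz : z₁ ≠ z₂)
    (h₁₂ : y₁ ≠ y₂) (h₁₃ : y₁ ≠ y₃) (h₂₃ : y₂ ≠ y₃)
    (hzy₁ : z₁ ≠ y₁) (hzy₂ : z₁ ≠ y₂) (hzy₃ : z₁ ≠ y₃)
    (hzy₁' : z₂ ≠ y₁) (hzy₂' : z₂ ≠ y₂) (hzy₃' : z₂ ≠ y₃)
    (hc₁ : c₁ ∉ P.used z₁) (hc₂ : c₂ ∉ P.used z₂) (hc : P.Ok z₁ c₁ z₂ c₂)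
    (hz₁ : (P.used z₁).card + 11 ≤ Fintype.card α) (hz₂ : (P.used z₂).card + 11 ≤ Fintype.card α)
    (hY₁ : (P.used y₁).card ≤ 5) (hY₂ : (P.used y₂).card ≤ 5) (hY₃ : (P.used y₃).card ≤ 6)
    (hα : (P.used y₁).card + (P.used y₂).card + (P.used y₃).card < Fintype.card α)
    (hα₁₂ : (P.used y₁).card + (P.used y₂).card + 6 ≤ Fintype.card α)
    (hα₁₃ : (P.used y₁).card + (P.used y₃).card + 6 ≤ Fintype.card α)
    (hα₂₃ : (P.used y₂).card + (P.used y₃).card + 6 ≤ Fintype.card α) :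
    P.Extendable {z₁, z₂, y₁, y₂, y₃} := by
  have : Nonempty α := ⟨c₁⟩
  by_cases hA₁ : ∃ a, a ∉ P.used z₁ ∧ a ∉ P.used y₁ ∧ a ∉ P.used y₂ ∧ a ∉ P.used y₃
  · obtain ⟨a, ha, ha₁, ha₂, ha₃⟩ := hA₁
    exact extend_three_of_fresh h₁₂ h₁₃ h₂₃ hzy₁ hzy₂ hzy₃ hc₁ hc₂ hc hz₁ hz₂ hY₁ hY₂ hY₃ hα hα₁₂
      hα₁₃ hα₂₃ ha ha₁ ha₂ ha₃
  by_cases hA₂ : ∃ a, a ∉ P.used z₂ ∧ a ∉ P.used y₁ ∧ a ∉ P.used y₂ ∧ a ∉ P.used y₃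
  · obtain ⟨a, ha, ha₁, ha₂, ha₃⟩ := hA₂
    rw [Set.insert_comm]
    exact extend_three_of_fresh h₁₂ h₁₃ h₂₃ hzy₁' hzy₂' hzy₃' hc₂ hc₁ hc.symm hz₂ hz₁ hY₁ hY₂ hY₃
      hα hα₁₂ hα₁₃ hα₂₃ ha ha₁ ha₂ ha₃
  obtain ⟨o, ho₁, ho₂₃, -⟩ := exists_avoid₂ (P.used y₁) (P.used y₂ ∪ P.used y₃) [] (by
    have := Finset.card_union_le (P.used y₂) (P.used y₃)
    simp; omega)
  simp only [Finset.mem_union, not_or] at ho₂₃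
  obtain ⟨ho₂, ho₃⟩ := ho₂₃
  push Not at hA₁ hA₂
  have ho : ∀ {z}, (∀ a ∉ P.used z, a ∉ P.used y₁ → a ∉ P.used y₂ → a ∈ P.used y₃) →
      o ∈ P.used z := fun h => by_contra fun h' => ho₃ (h o h' ho₁ ho₂)
  have place : ∀ {z z' y y' y'' : V} {g : α}, y' ≠ y'' → g ∉ P.used z → g ∉ P.used z' →
      g ∈ P.used y → g ∉ P.used y' → g ∉ P.used y'' → o ∉ P.used y → o ∉ P.used y' →
      o ∉ P.used y'' → ¬ P.conflict y o z g → (P.used z').card + 11 ≤ Fintype.card α →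
      (P.used y).card ≤ 6 → (P.used y').card ≤ 6 → (P.used y'').card ≤ 6 →
      (P.used y').card + (P.used y'').card + 6 ≤ Fintype.card α → o ∈ P.used z' →
      P.Extendable {z, z', y, y', y''} := by
    intro z z' y y' y'' g hyy hgz hgz' hgy hgy' hgy'' hoy hoy' hoy'' hcf hz' hy hy' hy'' hs hoz
    obtain ⟨h, hh, hhy, -⟩ := exists_avoid₂ (P.used z') (P.used y) [] (by simp; omega)
    obtain ⟨p, q, hp, hq, hpQ, hqQ, hp₁, hq₁, hpq⟩ :=
      P.exists_pair (z := z') (h := h) [g, o] hyy (by simp; omega) (by simp; omega)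
        (by simp; omega)
    simp only [List.mem_cons, List.not_mem_nil, or_false, forall_eq_or_imp, forall_eq] at hpQ hqQ
    refine extendable_of_list [(z, g), (z', h), (y, o), (y', p), (y'', q)] (by simp)
      (by simp [*]) ?_
    have hgh : g ≠ h := fun e => hhy (e ▸ hgy)
    have hgo : g ≠ o := fun e => hoy (e ▸ hgy)
    have hho : h ≠ o := fun e => hh (e ▸ hoz)
    have := ok_of_left (P := P) (v := z) hgh hgz'
    have : P.Ok z g y o := Ok.symm ⟨hgo.symm, hcf⟩
    have := ok_of_left (P := P) (v := z) hpQ.1.symm hgy'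
    have := ok_of_left (P := P) (v := z) hqQ.1.symm hgy''
    have := ok_of_left (P := P) (v := z') hho hhy
    have := ok_of_left (P := P) (v := y) hpQ.2.symm hoy'
    have := ok_of_left (P := P) (v := y) hqQ.2.symm hoy''
    simp [*]
  have side : ∀ {y y' y'' : V} {g : α}, y' ≠ y'' → g ∉ P.used z₁ → g ∉ P.used z₂ →
      g ∈ P.used y → g ∉ P.used y' → g ∉ P.used y'' → o ∉ P.used y → o ∉ P.used y' →
      o ∉ P.used y'' → (P.used y).card ≤ 6 → (P.used y').card ≤ 6 → (P.used y'').card ≤ 6 →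
      (P.used y').card + (P.used y'').card + 6 ≤ Fintype.card α →
      P.Extendable {z₁, z₂, y, y', y''} := by
    intro y y' y'' g hyy hg₁ hg₂ hgy hgy' hgy'' hoy hoy' hoy'' hy hy' hy'' hs
    by_cases hcf : P.conflict y o z₁ g
    · rw [Set.insert_comm]
      exact place hyy hg₂ hg₁ hgy hgy' hgy'' hoy hoy' hoy''
        (fun h => hz (P.unique hcf h)) hz₁ hy hy' hy'' hs (ho hA₁)
    · exact place hyy hg₁ hg₂ hgy hgy' hgy'' hoy hoy' hoy'' hcf hz₂ hy hy' hy'' hs (ho hA₂)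
  obtain ⟨g, hg₁, hg₂, hg, hg'⟩ : ∃ g, g ∉ P.used z₁ ∧ g ∉ P.used z₂ ∧
      g ∉ P.used y₁ ∩ P.used y₂ ∧ g ∉ (P.used y₁ ∪ P.used y₂) ∩ P.used y₃ := by
    by_contra! hne
    have hs₁ : (P.used z₁)ᶜ ⊆ P.used y₁ ∪ P.used y₂ ∪ P.used y₃ := fun a ha => by
      have := hA₁ a (by simpa using ha)
      simp only [Finset.mem_union]; tauto
    have hs₂ : (P.used z₂)ᶜ ⊆ P.used y₁ ∪ P.used y₂ ∪ P.used y₃ := fun a ha => by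
      have := hA₂ a (by simpa using ha)
      simp only [Finset.mem_union]; tauto
    have hs₃ : (P.used z₁)ᶜ ∩ (P.used z₂)ᶜ ⊆
        (P.used y₁ ∩ P.used y₂) ∪ ((P.used y₁ ∪ P.used y₂) ∩ P.used y₃) := fun a ha => by
      rw [Finset.mem_inter, Finset.mem_compl, Finset.mem_compl] at ha
      rw [Finset.mem_union]
      exact or_iff_not_imp_left.2 (hne a ha.1 ha.2)
    have e₁ := Finset.card_le_card (Finset.union_subset hs₁ hs₂)
    have e₂ := (Finset.card_le_card hs₃).trans (Finset.card_union_le _ _)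
    have e₃ := Finset.card_union_add_card_inter (P.used z₁)ᶜ (P.used z₂)ᶜ
    have e₄ := Finset.card_union_add_card_inter (P.used y₁) (P.used y₂)
    have e₅ := Finset.card_union_add_card_inter (P.used y₁ ∪ P.used y₂) (P.used y₃)
    rw [Finset.card_compl, Finset.card_compl] at e₃
    omega
  simp only [Finset.mem_inter, Finset.mem_union, not_and] at hg hg'
  by_cases hgy₁ : g ∈ P.used y₁
  · exact side h₂₃ hg₁ hg₂ hgy₁ (hg hgy₁) (hg' (Or.inl hgy₁)) ho₁ ho₂ ho₃ (by omega) (by omega) hY₃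
      hα₂₃
  by_cases hgy₂ : g ∈ P.used y₂
  · rw [Set.insert_comm y₁ y₂]
    exact side h₁₃ hg₁ hg₂ hgy₂ hgy₁ (hg' (Or.inr hgy₂)) ho₂ ho₁ ho₃ (by omega) (by omega) hY₃
      hα₁₃
  · rw [Set.pair_comm y₂ y₃, Set.insert_comm y₁ y₃]
    exact side h₁₂ hg₁ hg₂ (hA₁ g hg₁ hgy₁ hgy₂) hgy₁ hgy₂ ho₃ ho₁ ho₂ hY₃ (by omega) (by omega)
      hα₁₂

end ConflictSystem
end Conflict

section Coloring

open scoped Classical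

variable {α : Type*}

/-- One step along a path coloured alternately `c` and `d`; the second component of a state is
the colour of the edge to be used next. -/
def AltStep (G : SimpleGraph V) (φ : Sym2 V → α) (c d : α) (p q : V × α) : Prop :=
  G.Adj p.1 q.1 ∧ φ s(p.1, q.1) = p.2 ∧ (p.2 = c ∧ q.2 = d ∨ p.2 = d ∧ q.2 = c)

/-- The edges of `G` at a common vertex have distinct colours. -/
def LocallyProper (G : SimpleGraph V) (φ : Sym2 V → α) : Prop :=
  ∀ u v w, G.Adj u v → G.Adj u w → φ s(u, v) = φ s(u, w) → v = w

theorem ProperEC.locallyProper {G : SimpleGraph V} {k : ℕ} {φ : Sym2 V → Fin k}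
    (h : ProperEC G φ) : LocallyProper G φ := by
  intro u v w hv hw he
  by_contra hne
  exact h s(u, v) hv s(u, w) hw (by simp [hne, hv.ne']) ⟨u, by simp, by simp⟩ he

/-- The colours at a vertex. -/
noncomputable def usedColors [Fintype V] (G : SimpleGraph V) (φ : Sym2 V → α) (v : V) :
    Finset α :=
  (G.neighborFinset v).image fun u => φ s(v, u)

theorem mem_usedColors [Fintype V] {G : SimpleGraph V} {φ : Sym2 V → α} {v : V} {c : α} :
    c ∈ usedColors G φ v ↔ ∃ u, G.Adj v u ∧ φ s(v, u) = c := by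
  simp [usedColors]

theorem card_usedColors_le [Fintype V] (G : SimpleGraph V) (φ : Sym2 V → α) (v : V) :
    (usedColors G φ v).card ≤ G.degree v :=
  Finset.card_image_le

theorem AltStep.rightUnique {G : SimpleGraph V} {φ : Sym2 V → α} (h : LocallyProper G φ)
    {c d : α} (hcd : c ≠ d) : Relator.RightUnique (AltStep G φ c d) := by
  rintro ⟨u, γ⟩ ⟨v, δ⟩ ⟨w, ε⟩ ⟨h1, h2, h3⟩ ⟨h4, h5, h6⟩
  dsimp only at *
  refine Prod.ext (h u v w h1 h4 (h2.trans h5.symm)) ?_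
  dsimp only
  rcases h3 with h3 | h3 <;> rcases h6 with h6 | h6 <;> grind

theorem AltStep.reflTransGen_symm {G : SimpleGraph V} {φ : Sym2 V → α} {c d : α} {v w : V}
    (h : Relation.ReflTransGen (AltStep G φ c d) (v, d) (w, d)) :
    Relation.ReflTransGen (AltStep G φ d c) (w, c) (v, c) := by
  rw [← Relation.reflTransGen_swap] at h
  have := Relation.ReflTransGen.lift (p := AltStep G φ d c)
    (fun s : V × α => (s.1, Equiv.swap c d s.2)) ?_ _ _ h
  · simpa [Function.onFun] using this
  · rintro ⟨u, γ⟩ ⟨u', δ⟩ ⟨h1, h2, h3⟩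
    dsimp only at *
    refine ⟨h1.symm, ?_, ?_⟩ <;> rcases h3 with ⟨rfl, rfl⟩ | ⟨rfl, rfl⟩ <;>
      simp_all [Sym2.eq_swap (a := u)]

/-- The conflicts between the vertices of a properly coloured graph. -/
noncomputable def LocallyProper.conflictSystem [Fintype V] {G : SimpleGraph V} {φ : Sym2 V → α}
    (h : LocallyProper G φ) : ConflictSystem V α where
  used := usedColors G φ
  conflict v c w d := v ≠ w ∧ c ≠ d ∧ c ∉ usedColors G φ v ∧ d ∉ usedColors G φ w ∧
    Relation.ReflTransGen (AltStep G φ c d) (v, d) (w, d)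
  symm := fun ⟨h1, h2, h3, h4, h5⟩ => ⟨h1.symm, h2.symm, h4, h3, AltStep.reflTransGen_symm h5⟩
  mem_used := by
    rintro v c w d ⟨h1, h2, h3, h4, h5⟩
    rcases Relation.ReflTransGen.cases_tail h5 with h6 | ⟨⟨u, γ⟩, -, h7, h8, h9⟩
    · exact absurd (congrArg Prod.fst h6).symm h1
    · refine mem_usedColors.2 ⟨u, h7.symm, ?_⟩
      rw [Sym2.eq_swap]
      dsimp only at *
      grind
  unique := by
    rintro v c w w' d ⟨-, hcd, -, hw, hp⟩ ⟨-, -, -, hw', hp'⟩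
    have stuck : ∀ {w w'}, d ∉ usedColors G φ w →
        Relation.ReflTransGen (AltStep G φ c d) (w, d) (w', d) → w = w' := by
      intro w w' hw hp
      rcases Relation.ReflTransGen.cases_head hp with h6 | ⟨⟨u, γ⟩, ⟨h7, h8, -⟩, -⟩
      · exact congrArg Prod.fst h6
      · exact absurd (mem_usedColors.2 ⟨u, h7, h8⟩) hw
    rcases Relation.ReflTransGen.total_of_right_unique (AltStep.rightUnique h hcd) hp hp' with h1 | h1
    · exact stuck hw h1
    · exact (stuck hw' h1).symm

/-- An alternately coloured trail yields alternating steps. -/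
theorem AltStep.of_isTrail [Fintype V] {G : SimpleGraph V} {φ : Sym2 V → α}
    (h : LocallyProper G φ) {c d : α} {w : V} (hd : d ∉ usedColors G φ w) {u : V}
    (q : G.Walk u w) (hq : q.IsTrail) (hcol : ∀ e ∈ q.edges, φ e = c ∨ φ e = d) (γ : α)
    (hγ : γ = c ∨ γ = d) (hfirst : ∀ e ∈ q.edges, u ∈ e → φ e = γ) (hend : u = w → γ = d) :
    Relation.ReflTransGen (AltStep G φ c d) (u, γ) (w, d) := by
  induction q generalizing γ with
  | nil => rw [hend rfl]
  | @cons u v w hadj q ih =>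
    simp only [Walk.edges_cons, List.mem_cons, forall_eq_or_imp] at hcol hfirst
    rw [Walk.isTrail_cons] at hq
    have hγuv : φ s(u, v) = γ := hfirst.1 (by simp)
    have hex : ∃ δ, γ = c ∧ δ = d ∨ γ = d ∧ δ = c := by
      rcases hγ with h | h
      exacts [⟨d, Or.inl ⟨h, rfl⟩⟩, ⟨c, Or.inr ⟨h, rfl⟩⟩]
    obtain ⟨δ, hδ⟩ := hex
    refine Relation.ReflTransGen.head (b := (v, δ)) ⟨hadj, hγuv, hδ⟩
      (ih hd hq.1 hcol.2 δ (by tauto) ?_ ?_)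
    · intro e he hve
      have hne : φ e ≠ γ := by
        intro heq
        obtain ⟨t, rfl⟩ := Sym2.mem_iff_exists.1 hve
        have := h v u t hadj.symm (q.adj_of_mem_edges he)
          (by rw [heq, Sym2.eq_swap, hγuv])
        subst this
        exact hq.2 (by rwa [Sym2.eq_swap])
      have := hcol.2 e he
      grind
    · rintro rfl
      have : γ ≠ d := fun e => hd (mem_usedColors.2 ⟨u, hadj.symm, by rw [Sym2.eq_swap, hγuv, e]⟩)
      tauto

/-- Alternating steps yield a walk with two colours. -/
theorem AltStep.exists_walk {G : SimpleGraph V} {φ : Sym2 V → α} {c d : α} {p q : V × α}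
    (h : Relation.ReflTransGen (AltStep G φ c d) p q) :
    ∃ r : G.Walk p.1 q.1, ∀ e ∈ r.edges, φ e = c ∨ φ e = d := by
  induction h with
  | refl => exact ⟨Walk.nil, by simp⟩
  | tail _ hs ih =>
    obtain ⟨r, hr⟩ := ih
    refine ⟨r.concat hs.1, fun e he => ?_⟩
    simp only [Walk.edges_concat, List.concat_eq_append, List.mem_append, List.mem_singleton] at he
    rcases he with he | rfl
    · exact hr e he
    · rw [hs.2.1]; have := hs.2.2; tauto

theorem ProperEC.mono {G H : SimpleGraph V} (hle : H ≤ G) {k : ℕ} {φ : Sym2 V → Fin k}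
    (h : ProperEC G φ) : ProperEC H φ :=
  fun e₁ h₁ e₂ h₂ => h e₁ (SimpleGraph.edgeSet_mono hle h₁) e₂ (SimpleGraph.edgeSet_mono hle h₂)

theorem AcyclicEC.mono {G H : SimpleGraph V} (hle : H ≤ G) {k : ℕ} {φ : Sym2 V → Fin k}
    (h : AcyclicEC G φ) : AcyclicEC H φ := by
  refine ⟨h.1.mono hle, fun v w hw => ?_⟩
  have := h.2 v (w.mapLe hle) (hw.mapLe hle)
  simpa using this

theorem card_le_two_of_forall {β : Type*} {s : Finset β} {c d : β}
    (h : ∀ e ∈ s, e = c ∨ e = d) : s.card ≤ 2 :=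
  (Finset.card_le_card fun e he => by simpa using h e he).trans (Finset.card_le_two (a := c) (b := d))

theorem AcyclicEC.notMem_usedColors [Fintype V] {G H : SimpleGraph V} (hle : H ≤ G) {k : ℕ}
    {φ : Sym2 V → Fin k} (h : AcyclicEC G φ) {x v : V} (hx : ∀ u, ¬ H.Adj x u) (hv : G.Adj x v) :
    φ s(x, v) ∉ usedColors H φ v := by
  rw [mem_usedColors]
  rintro ⟨u, hu, he⟩
  have := h.1.locallyProper v u x (hle hu) hv.symm (by rw [he, Sym2.eq_swap])
  exact hx v (this ▸ hu).symm

/-- The colours at `x` of an acyclic colouring are compatible after deleting `x`. -/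
theorem AcyclicEC.ok [Fintype V] {G H : SimpleGraph V} (hle : H ≤ G) {k : ℕ}
    {φ : Sym2 V → Fin k} (h : AcyclicEC G φ) (hp : LocallyProper H φ) {x v w : V}
    (hx : ∀ u, ¬ H.Adj x u) (hv : G.Adj x v) (hw : G.Adj x w) (hvw : v ≠ w) :
    hp.conflictSystem.Ok v (φ s(x, v)) w (φ s(x, w)) := by
  refine ⟨fun e => hvw (h.1.locallyProper x v w hv hw e), ?_⟩
  rintro ⟨-, -, -, -, hr⟩
  obtain ⟨r, hr⟩ := AltStep.exists_walk hr
  dsimp only at r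
  have hxr : ∀ {a b : V} (q : H.Walk a b), a ≠ x → x ∉ q.support := by
    intro a b q ha hq
    induction q with
    | nil => simp at hq; exact ha hq.symm
    | cons hadj q ih =>
      rw [Walk.support_cons, List.mem_cons] at hq
      exact ih (fun e => hx _ (e ▸ hadj.symm)) (hq.resolve_left ha.symm)
  set q := r.bypass.mapLe hle with hq
  have hqc : ∀ e ∈ q.edges, φ e = φ s(x, v) ∨ φ e = φ s(x, w) := by
    intro e he
    rw [hq, Walk.edges_mapLe_eq_edges] at he
    exact hr e (r.edges_bypass_subset_edges he)
  have hqp : q.IsPath := r.bypass_isPath.mapLe hle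
  have hxq : x ∉ q.support := by
    rw [hq, Walk.support_mapLe_eq_support]
    exact hxr _ hv.ne'
  have hcyc : (Walk.cons hv (q.concat hw.symm)).IsCycle := by
    rw [Walk.cons_isCycle_iff, Walk.edges_concat]
    refine ⟨hqp.concat hxq hw.symm, ?_⟩
    simp only [List.concat_eq_append, List.mem_append, List.mem_singleton, not_or]
    exact ⟨fun he => hxq (q.fst_mem_support_of_mem_edges he), by simp [hvw, hw.ne]⟩
  have := h.2 x _ hcyc
  refine absurd (card_le_two_of_forall (c := φ s(x, v)) (d := φ s(x, w)) fun e he => ?_) this.not_ge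
  simp only [Walk.edges_cons, Walk.edges_concat, List.mem_toFinset, List.mem_map] at he
  obtain ⟨e, he, rfl⟩ := he
  simp only [List.concat_eq_append, List.mem_cons, List.mem_append, List.not_mem_nil,
    or_false] at he
  rcases he with rfl | he | rfl
  · exact Or.inl rfl
  · exact hqc e he
  · exact Or.inr (by rw [Sym2.eq_swap])

/-- A compatible choice of colours at `x` extends an acyclic colouring of the graph without
`x`. -/
theorem AcyclicEC.hasAEC_of_extendable [Fintype V] {G H : SimpleGraph V} {x : V} {k : ℕ}
    {φ : Sym2 V → Fin k} (h : AcyclicEC H φ)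
    (hH : ∀ {u v}, H.Adj u v ↔ G.Adj u v ∧ u ≠ x ∧ v ≠ x)
    (hext : h.1.locallyProper.conflictSystem.Extendable (G.neighborSet x)) : HasAEC G k := by
  obtain ⟨col, hcol₁, hcol₂⟩ := hext
  let ψ : Sym2 V → Fin k := fun e => if he : ∃ v, e = s(x, v) then col he.choose else φ e
  have ψx : ∀ v, ψ s(x, v) = col v := by
    intro v
    have he : ∃ v', s(x, v) = s(x, v') := ⟨v, rfl⟩
    have hv : he.choose = v := (Sym2.congr_right.1 he.choose_spec).symm
    simp only [ψ, dif_pos he, hv]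
  have ψne : ∀ e, x ∉ e → ψ e = φ e := by
    intro e he
    have : ¬ ∃ v, e = s(x, v) := by rintro ⟨v, rfl⟩; simp at he
    simp only [ψ, dif_neg this]
  have hHe : ∀ e ∈ G.edgeSet, x ∉ e → e ∈ H.edgeSet := by
    intro e
    induction e with
    | h u v =>
      intro he hx
      simp only [Sym2.mem_iff, not_or] at hx
      exact hH.2 ⟨he, Ne.symm hx.1, Ne.symm hx.2⟩
  have mixed : ∀ v, G.Adj x v → ∀ e ∈ H.edgeSet, v ∈ e → col v ≠ φ e := by
    intro v hv e he hve heq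
    obtain ⟨u, rfl⟩ := Sym2.mem_iff_exists.1 hve
    exact hcol₁ v hv (mem_usedColors.2 ⟨u, he, heq.symm⟩)
  refine ⟨ψ, ?_, ?_⟩
  · rintro e₁ h₁ e₂ h₂ hne ⟨t, ht₁, ht₂⟩
    by_cases hx₁ : x ∈ e₁ <;> by_cases hx₂ : x ∈ e₂
    · obtain ⟨v, rfl⟩ := Sym2.mem_iff_exists.1 hx₁
      obtain ⟨w, rfl⟩ := Sym2.mem_iff_exists.1 hx₂
      rw [ψx, ψx]
      exact (hcol₂ v h₁ w h₂ fun e => hne (e ▸ rfl)).1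
    · obtain ⟨v, rfl⟩ := Sym2.mem_iff_exists.1 hx₁
      rw [ψx, ψne _ hx₂]
      rcases Sym2.mem_iff.1 ht₁ with rfl | rfl
      · exact absurd ht₂ hx₂
      · exact mixed t h₁ e₂ (hHe _ h₂ hx₂) ht₂
    · obtain ⟨v, rfl⟩ := Sym2.mem_iff_exists.1 hx₂
      rw [ψx, ψne _ hx₁]
      rcases Sym2.mem_iff.1 ht₂ with rfl | rfl
      · exact absurd ht₁ hx₁
      · exact (mixed t h₂ e₁ (hHe _ h₁ hx₁) ht₁).symm
    · rw [ψne _ hx₁, ψne _ hx₂]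
      exact h.1 e₁ (hHe _ h₁ hx₁) e₂ (hHe _ h₂ hx₂) hne ⟨t, ht₁, ht₂⟩
  · intro b C hC
    by_cases hxC : x ∈ C.support
    swap
    · have hxe : ∀ e ∈ C.edges, x ∉ e := fun e he hx => hxC (C.mem_support_of_mem_edges he hx)
      have hE : ∀ e ∈ C.edges, e ∈ H.edgeSet := fun e he =>
        hHe e (C.edges_subset_edgeSet he) (hxe e he)
      have := h.2 b (C.transfer H hE) (hC.transfer hE)
      rw [Walk.edges_transfer] at this
      rwa [List.map_congr_left fun e he => ψne e (hxe e he)]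
    obtain ⟨D, hD, hCD⟩ : ∃ D : G.Walk x x, D.IsCycle ∧
        (D.edges.map ψ).toFinset = (C.edges.map ψ).toFinset := by
      refine ⟨C.rotate x hxC, hC.rotate hxC, ?_⟩
      ext e
      simp only [List.mem_toFinset, List.mem_map, (C.rotate_edges x hxC).mem_iff]
    rw [← hCD]
    by_contra! hle
    cases D with
    | nil => exact hD.not_nil Walk.nil_nil
    | @cons _ v _ hv p =>
    rw [Walk.cons_isCycle_iff] at hD
    obtain ⟨hp, hnot⟩ := hD
    obtain ⟨p', hp'⟩ : ∃ p' : G.Walk x v, p' = p.reverse := ⟨_, rfl⟩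
    have hpe : ∀ e, e ∈ p.edges ↔ e ∈ p'.edges := by simp [hp']
    have hp'p : p'.IsPath := by rw [hp']; exact hp.reverse
    cases p' with
    | nil => exact hv.ne rfl
    | @cons _ w _ hw q =>
    rw [Walk.cons_isPath_iff] at hp'p
    obtain ⟨hq, hxq⟩ := hp'p
    simp only [hpe, Walk.edges_cons, List.mem_cons, not_or] at hnot
    have hvw : w ≠ v := fun e => hnot.1 (e ▸ rfl)
    have hok := hcol₂ w hw v hv hvw
    have hxe : ∀ e ∈ q.edges, x ∉ e := fun e he hx => hxq (q.mem_support_of_mem_edges he hx)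
    have hE : ∀ e ∈ q.edges, e ∈ H.edgeSet := fun e he =>
      hHe e (q.edges_subset_edgeSet he) (hxe e he)
    have hin : ∀ e, e = s(x, v) ∨ e = s(x, w) ∨ e ∈ q.edges →
        ψ e ∈ ((Walk.cons hv p).edges.map ψ).toFinset := by
      intro e he
      rw [List.mem_toFinset]
      refine List.mem_map_of_mem ?_
      simp only [Walk.edges_cons, List.mem_cons, hpe]
      exact he
    have hcd : ∀ e ∈ q.edges, φ e = col w ∨ φ e = col v := by
      intro e he
      by_contra! hne
      rw [← ψne e (hxe e he)] at hne
      refine absurd hle (not_le.2 (Finset.two_lt_card.2 ⟨ψ e, hin e (by simp [he]), col w, ?_, col v,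
        ?_, hne.1, hne.2, hok.1⟩))
      · rw [← ψx]; exact hin _ (by simp)
      · rw [← ψx]; exact hin _ (by simp)
    refine hok.2 ⟨hvw, hok.1, hcol₁ w hw, hcol₁ v hv, ?_⟩
    refine AltStep.of_isTrail h.1.locallyProper (hcol₁ v hv) (q.transfer H hE)
      (hq.transfer hE).isTrail (by simpa using hcd) (col v) (Or.inr rfl) ?_ (fun _ => rfl)
    intro e he hwe
    rw [Walk.edges_transfer] at he
    exact (hcd e he).resolve_left fun heq => mixed w hw e (hE e he) hwe heq.symm

end Coloring

section Critical

open scoped Classical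

variable {G : SimpleGraph V} {Δ : ℕ}

theorem AcyclicallyEdgeCritical.exists_deleteIncidenceSet {k : ℕ}
    (hG : AcyclicallyEdgeCritical G k) {x v : V} (hv : G.Adj x v) :
    ∃ φ : Sym2 V → Fin k, AcyclicEC (G.deleteIncidenceSet x) φ := by
  refine hG.2 _ (deleteIncidenceSet_le G x) fun h => ?_
  rw [← h, deleteIncidenceSet_adj] at hv
  exact hv.2.1 rfl

variable [Fintype V]

theorem card_usedColors_le_of_le {α : Type*} (φ : Sym2 V → α) {H : SimpleGraph V} (hle : H ≤ G)
    (v : V) : (usedColors H φ v).card ≤ G.degree v :=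
  (card_usedColors_le H φ v).trans (degree_le_of_le hle)

theorem card_usedColors_lt {α : Type*} (φ : Sym2 V → α) {H : SimpleGraph V} (hle : H ≤ G)
    {x v : V} (hv : G.Adj v x) (hH : ¬ H.Adj v x) :
    (usedColors H φ v).card + 1 ≤ G.degree v := by
  have h₁ := card_usedColors_le H φ v
  have h₂ : H.neighborFinset v ⊂ G.neighborFinset v := by
    refine Finset.ssubset_iff_subset_ne.2 ⟨fun u hu => ?_, fun h => hH ?_⟩
    · rw [mem_neighborFinset] at hu ⊢
      exact hle hu
    · rwa [← mem_neighborFinset, h, mem_neighborFinset]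
  have h₃ := Finset.card_lt_card h₂
  rw [card_neighborFinset_eq_degree, card_neighborFinset_eq_degree] at h₃
  omega

theorem card_usedColors_deleteIncidenceSet_lt {α : Type*} (φ : Sym2 V → α) {x v : V}
    (hv : G.Adj x v) : (usedColors (G.deleteIncidenceSet x) φ v).card + 1 ≤ G.degree v :=
  card_usedColors_lt φ (deleteIncidenceSet_le G x) hv.symm
    fun h => (deleteIncidenceSet_adj.1 h).2.2 rfl

theorem AcyclicallyEdgeCritical.not_extendable {k : ℕ}
    (hG : AcyclicallyEdgeCritical G k) {x : V} {φ : Sym2 V → Fin k}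
    (hφ : AcyclicEC (G.deleteIncidenceSet x) φ) :
    ¬ hφ.1.locallyProper.conflictSystem.Extendable (G.neighborSet x) :=
  fun h => hG.1 (hφ.hasAEC_of_extendable deleteIncidenceSet_adj h)

/-- Delete all but two of the edges at `x`, colour, and forget the two remaining edges. -/
theorem AcyclicallyEdgeCritical.exists_compatible {k : ℕ} (hG : AcyclicallyEdgeCritical G k)
    {x z₁ z₂ y : V} (h₁ : G.Adj x z₁) (h₂ : G.Adj x z₂) (hy : G.Adj x y) (h₁₂ : z₁ ≠ z₂)
    (hy₁ : z₁ ≠ y) (hy₂ : z₂ ≠ y) :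
    ∃ (φ : Sym2 V → Fin k) (hφ : AcyclicEC (G.deleteIncidenceSet x) φ) (c₁ c₂ : Fin k),
      c₁ ∉ hφ.1.locallyProper.conflictSystem.used z₁ ∧
      c₂ ∉ hφ.1.locallyProper.conflictSystem.used z₂ ∧
      hφ.1.locallyProper.conflictSystem.Ok z₁ c₁ z₂ c₂ := by
  set G' := G.deleteEdges {e | ∃ u, u ≠ z₁ ∧ u ≠ z₂ ∧ e = s(x, u)} with hG'
  have hne : G' ≠ G := by
    intro h
    rw [← h, hG', deleteEdges_adj] at hy
    exact hy.2 ⟨y, hy₁.symm, hy₂.symm, rfl⟩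
  obtain ⟨φ, hφ⟩ := hG.2 G' (deleteEdges_le _) hne
  have hle : G.deleteIncidenceSet x ≤ G' := by
    intro u v h
    rw [deleteIncidenceSet_adj] at h
    rw [hG', deleteEdges_adj]
    refine ⟨h.1, ?_⟩
    rintro ⟨w, -, -, hw⟩
    rcases Sym2.mem_iff.1 (hw ▸ Sym2.mem_mk_left x w) with e | e
    exacts [h.2.1 e.symm, h.2.2 e.symm]
  have hadj : ∀ {z}, G.Adj x z → z = z₁ ∨ z = z₂ → G'.Adj x z := by
    intro z hz hz'
    rw [hG', deleteEdges_adj]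
    refine ⟨hz, ?_⟩
    rintro ⟨w, hw₁, hw₂, hw⟩
    obtain rfl := Sym2.congr_right.1 hw
    tauto
  have hx : ∀ u, ¬ (G.deleteIncidenceSet x).Adj x u := fun u hu =>
    (deleteIncidenceSet_adj.1 hu).2.1 rfl
  exact ⟨φ, hφ.mono hle, φ s(x, z₁), φ s(x, z₂),
    hφ.notMem_usedColors hle hx (hadj h₁ (Or.inl rfl)),
    hφ.notMem_usedColors hle hx (hadj h₂ (Or.inr rfl)),
    hφ.ok hle _ hx (hadj h₁ (Or.inl rfl)) (hadj h₂ (Or.inr rfl)) h₁₂⟩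

theorem AcyclicallyEdgeCritical.neighborSet_ne_singleton
    (hG : AcyclicallyEdgeCritical G (Δ + 10)) (hΔ : ∀ v, G.degree v ≤ Δ) (x z : V) :
    G.neighborSet x ≠ {z} := by
  intro hN
  have hz : G.Adj x z := by simp [← mem_neighborSet, hN]
  obtain ⟨φ, hφ⟩ := hG.exists_deleteIncidenceSet hz
  have hcard := card_usedColors_deleteIncidenceSet_lt φ hz
  have := hΔ z
  obtain ⟨c, hc, -⟩ := ConflictSystem.exists_avoid
    (usedColors (G.deleteIncidenceSet x) φ z) [] (by simp; omega)
  have : Nonempty (Fin (Δ + 10)) := ⟨c⟩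
  refine hG.not_extendable hφ ?_
  rw [hN]
  exact ConflictSystem.extendable_of_list [(z, c)] (by simp) (by simpa [LocallyProper.conflictSystem] using hc) (by simp)

/-- The neighbours of a vertex of degree two are adjacent to many vertices of large degree. -/
theorem AcyclicallyEdgeCritical.rich_of_neighborSet_eq_pair
    (hG : AcyclicallyEdgeCritical G (Δ + 10)) (hΔ : ∀ v, G.degree v ≤ Δ) {x z₁ z₂ : V}
    (h₁₂ : z₁ ≠ z₂) (hN : G.neighborSet x = {z₁, z₂}) :
    11 ≤ ((G.neighborFinset z₁).filter fun u => u ≠ x ∧ 12 ≤ G.degree u).card := by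
  have h₁ : G.Adj x z₁ := by simp [← mem_neighborSet, hN]
  have h₂ : G.Adj x z₂ := by simp [← mem_neighborSet, hN]
  obtain ⟨φ, hφ⟩ := hG.exists_deleteIncidenceSet h₁
  have hnot := hG.not_extendable hφ
  have hp := hφ.1.locallyProper
  set H := G.deleteIncidenceSet x with hH
  have hcard₁ := card_usedColors_deleteIncidenceSet_lt φ h₁
  have hcard₂ := card_usedColors_deleteIncidenceSet_lt φ h₂
  rw [← hH] at hcard₁ hcard₂
  have hΔ₁ := hΔ z₁
  have hΔ₂ := hΔ z₂
  have hc₁ : 11 ≤ (usedColors H φ z₁)ᶜ.card := by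
    rw [Finset.card_compl, Fintype.card_fin]; omega
  have hc₂ : 11 ≤ (usedColors H φ z₂)ᶜ.card := by
    rw [Finset.card_compl, Fintype.card_fin]; omega
  have hconf : ∀ a ∉ usedColors H φ z₁, ∀ b ∉ usedColors H φ z₂, a ≠ b →
      hp.conflictSystem.conflict z₁ a z₂ b := by
    intro a ha b hb hab
    by_contra hcf
    refine hnot ?_
    rw [hN]
    have : Nonempty (Fin (Δ + 10)) := ⟨a⟩
    exact ConflictSystem.extendable_of_list [(z₁, a), (z₂, b)] (by simp)
      (by simpa [LocallyProper.conflictSystem] using ⟨ha, hb⟩) (by simpa using ⟨hab, hcf⟩)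
  have hdisj : ∀ a ∉ usedColors H φ z₁, a ∈ usedColors H φ z₂ := by
    intro a ha
    by_contra ha₂
    obtain ⟨b, hb⟩ : ((usedColors H φ z₂)ᶜ.erase a).Nonempty := by
      rw [← Finset.card_pos]
      have := Finset.pred_card_le_card_erase (s := (usedColors H φ z₂)ᶜ) (a := a)
      omega
    simp only [Finset.mem_erase, Finset.mem_compl] at hb
    exact ha₂ (hp.conflictSystem.mem_used (hconf a ha b hb.2 (Ne.symm hb.1)))
  have hex : ∀ b, b ∉ usedColors H φ z₂ →
      ∃ u, H.Adj z₁ u ∧ φ s(z₁, u) = b ∧ 12 ≤ G.degree u := by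
    intro b hb
    have hb₁ : b ∈ usedColors H φ z₁ := by_contra fun h => hb (hdisj b h)
    obtain ⟨u, hu, hub⟩ := mem_usedColors.1 hb₁
    refine ⟨u, hu, hub, ?_⟩
    have hsub : insert b (usedColors H φ z₁)ᶜ ⊆ usedColors H φ u := by
      intro a ha
      rcases Finset.mem_insert.1 ha with rfl | ha
      · exact mem_usedColors.2 ⟨z₁, hu.symm, by rw [Sym2.eq_swap, hub]⟩
      rw [Finset.mem_compl] at ha
      have hab : a ≠ b := fun e => ha (e ▸ hb₁)
      obtain ⟨-, -, -, -, hr⟩ := hconf a ha b hb hab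
      rcases Relation.ReflTransGen.cases_head hr with he | ⟨⟨u', γ⟩, ⟨h3, h4, h5⟩, hr'⟩
      · exact absurd (congrArg Prod.fst he) h₁₂
      dsimp only at h3 h4 h5
      obtain rfl := hp z₁ u u' hu h3 (hub.trans h4.symm)
      have hγ : γ = a := by grind
      subst hγ
      rcases Relation.ReflTransGen.cases_head hr' with he | ⟨⟨u', δ⟩, ⟨h6, h7, -⟩, -⟩
      · exact absurd (congrArg Prod.snd he) hab
      · exact mem_usedColors.2 ⟨u', h6, h7⟩
    have hle := Finset.card_le_card hsub
    rw [Finset.card_insert_of_notMem (by simpa using hb₁)] at hle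
    have h3 := card_usedColors_le_of_le φ (deleteIncidenceSet_le G x) u
    rw [← hH] at h3
    omega
  have : Nonempty V := ⟨x⟩
  choose! f hf using hex
  refine hc₂.trans (Finset.card_le_card_of_injOn f ?_ ?_)
  · intro b hb
    obtain ⟨h3, -, h4⟩ := hf b (by simpa using hb)
    rw [hH, deleteIncidenceSet_adj] at h3
    simp [h3.1, h3.2.2, h4]
  · intro b hb b' hb' he
    rw [← (hf b (by simpa using hb)).2.1, ← (hf b' (by simpa using hb')).2.1, he]

theorem AcyclicallyEdgeCritical.neighborSet_ne_three
    (hG : AcyclicallyEdgeCritical G (Δ + 10)) (hΔ : ∀ v, G.degree v ≤ Δ) (h3 : 3 ≤ Δ)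
    {x z₁ z₂ y : V} (hnd : [z₁, z₂, y].Nodup) (hy : G.degree y ≤ 11) :
    G.neighborSet x ≠ {z₁, z₂, y} := by
  intro hN
  simp only [List.nodup_cons, List.mem_cons, List.not_mem_nil, or_false, not_or,
    not_false_eq_true, List.nodup_nil, and_true] at hnd
  have h₁ : G.Adj x z₁ := by simp [← mem_neighborSet, hN]
  have h₂ : G.Adj x z₂ := by simp [← mem_neighborSet, hN]
  have hxy : G.Adj x y := by simp [← mem_neighborSet, hN]
  obtain ⟨φ, hφ, c₁, c₂, hc₁, hc₂, hc⟩ :=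
    hG.exists_compatible h₁ h₂ hxy hnd.1.1 hnd.1.2 hnd.2
  refine hG.not_extendable hφ ?_
  have u₁ := card_usedColors_deleteIncidenceSet_lt φ h₁
  have u₂ := card_usedColors_deleteIncidenceSet_lt φ h₂
  have u₃ := card_usedColors_deleteIncidenceSet_lt φ hxy
  have := hΔ z₁
  have := hΔ z₂
  rw [hN]
  refine ConflictSystem.extend_one hnd.1.1 hnd.1.2 hc₁ hc₂ hc ?_ ?_ ?_ ?_ <;>
    try simp only [LocallyProper.conflictSystem, Fintype.card_fin]
  all_goals omega

theorem AcyclicallyEdgeCritical.neighborSet_ne_four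
    (hG : AcyclicallyEdgeCritical G (Δ + 10)) (hΔ : ∀ v, G.degree v ≤ Δ)
    {x z₁ z₂ y₁ y₂ : V} (hnd : [z₁, z₂, y₁, y₂].Nodup) (hy₁ : G.degree y₁ ≤ 9)
    (hy₂ : G.degree y₂ ≤ 9) (hy : G.degree y₁ + G.degree y₂ ≤ 15) :
    G.neighborSet x ≠ {z₁, z₂, y₁, y₂} := by
  intro hN
  simp only [List.nodup_cons, List.mem_cons, List.not_mem_nil, or_false, not_or,
    not_false_eq_true, List.nodup_nil, and_true] at hnd
  have h₁ : G.Adj x z₁ := by simp [← mem_neighborSet, hN]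
  have h₂ : G.Adj x z₂ := by simp [← mem_neighborSet, hN]
  have hxy₁ : G.Adj x y₁ := by simp [← mem_neighborSet, hN]
  have hxy₂ : G.Adj x y₂ := by simp [← mem_neighborSet, hN]
  obtain ⟨φ, hφ, c₁, c₂, hc₁, hc₂, hc⟩ :=
    hG.exists_compatible h₁ h₂ hxy₁ hnd.1.1 hnd.1.2.1 hnd.2.1.1
  refine hG.not_extendable hφ ?_
  have u₁ := card_usedColors_deleteIncidenceSet_lt φ h₁
  have u₂ := card_usedColors_deleteIncidenceSet_lt φ h₂
  have u₃ := card_usedColors_deleteIncidenceSet_lt φ hxy₁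
  have u₄ := card_usedColors_deleteIncidenceSet_lt φ hxy₂
  have := hΔ z₁
  have := hΔ z₂
  have := hΔ y₁
  have := hΔ y₂
  rw [hN]
  refine ConflictSystem.extend_two hnd.1.1 hnd.2.2 hnd.1.2.1 hnd.1.2.2 hnd.2.1.1 hnd.2.1.2
    hc₁ hc₂ hc ?_ ?_ ?_ ?_ ?_ ?_ <;>
    try simp only [LocallyProper.conflictSystem, Fintype.card_fin]
  all_goals omega

theorem AcyclicallyEdgeCritical.neighborSet_ne_five
    (hG : AcyclicallyEdgeCritical G (Δ + 10)) (hΔ : ∀ v, G.degree v ≤ Δ)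
    {x z₁ z₂ y₁ y₂ y₃ : V} (hnd : [z₁, z₂, y₁, y₂, y₃].Nodup) (hy₁ : G.degree y₁ ≤ 6)
    (hy₂ : G.degree y₂ ≤ 6) (hy₃ : G.degree y₃ ≤ 7) :
    G.neighborSet x ≠ {z₁, z₂, y₁, y₂, y₃} := by
  intro hN
  simp only [List.nodup_cons, List.mem_cons, List.not_mem_nil, or_false, not_or,
    not_false_eq_true, List.nodup_nil, and_true] at hnd
  have h₁ : G.Adj x z₁ := by simp [← mem_neighborSet, hN]
  have h₂ : G.Adj x z₂ := by simp [← mem_neighborSet, hN]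
  have hxy₁ : G.Adj x y₁ := by simp [← mem_neighborSet, hN]
  have hxy₂ : G.Adj x y₂ := by simp [← mem_neighborSet, hN]
  have hxy₃ : G.Adj x y₃ := by simp [← mem_neighborSet, hN]
  obtain ⟨φ, hφ, c₁, c₂, hc₁, hc₂, hc⟩ :=
    hG.exists_compatible h₁ h₂ hxy₁ hnd.1.1 hnd.1.2.1 hnd.2.1.1
  refine hG.not_extendable hφ ?_
  have u₁ := card_usedColors_deleteIncidenceSet_lt φ h₁
  have u₂ := card_usedColors_deleteIncidenceSet_lt φ h₂
  have u₃ := card_usedColors_deleteIncidenceSet_lt φ hxy₁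
  have u₄ := card_usedColors_deleteIncidenceSet_lt φ hxy₂
  have u₅ := card_usedColors_deleteIncidenceSet_lt φ hxy₃
  have := hΔ z₁
  have := hΔ z₂
  have := hΔ y₁
  have := hΔ y₂
  have := hΔ y₃
  rw [hN]
  refine ConflictSystem.extend_three hnd.1.1 hnd.2.2.1.1 hnd.2.2.1.2 hnd.2.2.2 hnd.1.2.1
    hnd.1.2.2.1 hnd.1.2.2.2 hnd.2.1.1 hnd.2.1.2.1 hnd.2.1.2.2 hc₁ hc₂ hc ?_ ?_ ?_ ?_ ?_ ?_ ?_ ?_ ?_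
    <;> try simp only [LocallyProper.conflictSystem, Fintype.card_fin]
  all_goals omega

end Critical

section Minor

variable {W : Type*} {G H : SimpleGraph V} {K : SimpleGraph W}

theorem induce_connected_of_forall_cut {s : Set V} (hs : s.Nonempty)
    (h : ∀ t ⊆ s, t.Nonempty → t ≠ s → ∃ a ∈ t, ∃ b ∈ s, b ∉ t ∧ G.Adj a b) :
    (G.induce s).Connected := by
  obtain ⟨x, hx⟩ := hs
  rw [connected_iff_exists_forall_reachable]
  refine ⟨⟨x, hx⟩, ?_⟩
  by_contra! hcon
  obtain ⟨⟨y, hy⟩, hxy⟩ := hcon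
  obtain ⟨a, ⟨ha, hxa⟩, b, hb, hbt, hab⟩ :=
    h {z | ∃ hz : z ∈ s, (G.induce s).Reachable ⟨x, hx⟩ ⟨z, hz⟩} (fun z hz => hz.1)
      ⟨x, hx, .rfl⟩ (fun e => hxy (by rw [← e] at hy; exact hy.2))
  exact hbt ⟨hb, hxa.trans (Adj.reachable (by simpa using hab))⟩

theorem exists_adj_of_induce_connected {s : Set V} (h : (G.induce s).Connected) {t : Set V}
    (hts : t ⊆ s) (ht : t.Nonempty) (hne : t ≠ s) : ∃ a ∈ t, ∃ b ∈ s, b ∉ t ∧ G.Adj a b := by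
  obtain ⟨x, hx⟩ := ht
  obtain ⟨y, hy, hyt⟩ := Set.exists_of_ssubset (hts.ssubset_of_ne hne)
  obtain ⟨p⟩ := h.preconnected ⟨x, hts hx⟩ ⟨y, hy⟩
  obtain ⟨d, -, hd₁, hd₂⟩ := p.exists_boundary_dart {z | z.1 ∈ t} hx hyt
  exact ⟨d.fst, hd₁, d.snd, d.snd.2, hd₂, by simpa using d.adj⟩

theorem HasMinor.mono (hle : G ≤ H) : HasMinor G K → HasMinor H K := by
  rintro ⟨f, hf, hd, ha⟩
  refine ⟨f, fun w => ⟨(hf w).1, (hf w).2.mono fun a b h => hle h⟩, hd, fun w₁ w₂ hw => ?_⟩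
  obtain ⟨a, h₁, b, h₂, hab⟩ := ha w₁ w₂ hw
  exact ⟨a, h₁, b, h₂, hle hab⟩

/-- The graph in which `u` is isolated and its neighbours are joined to `v`. -/
def mergeInto (G : SimpleGraph V) (u v : V) : SimpleGraph V where
  Adj a b := a ≠ b ∧ a ≠ u ∧ b ≠ u ∧ (G.Adj a b ∨ a = v ∧ G.Adj u b ∨ b = v ∧ G.Adj a u)
  symm.symm := by
    rintro a b ⟨h, ha, hb, hab⟩
    refine ⟨h.symm, hb, ha, ?_⟩
    rw [G.adj_comm b a, G.adj_comm u a, G.adj_comm b u]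
    tauto
  loopless.irrefl _ h := h.1 rfl

/-- Contracting an edge yields a minor. -/
theorem HasMinor.of_mergeInto {u v : V} (huv : G.Adj u v) (hK : ∀ w, ∃ w', K.Adj w w')
    (h : HasMinor (mergeInto G u v) K) : HasMinor G K := by
  classical
  obtain ⟨f, hf, hd, ha⟩ := h
  have hu : ∀ w, u ∉ f w := by
    intro w huw
    by_cases hs : {u} = f w
    · obtain ⟨w', hw'⟩ := hK w
      obtain ⟨a, h₁, b, -, hab⟩ := ha w w' hw'
      rw [← hs] at h₁
      exact hab.2.1 h₁
    · obtain ⟨a, h₁, b, -, -, hab⟩ := exists_adj_of_induce_connected (hf w).2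
        (Set.singleton_subset_iff.2 huw) (Set.singleton_nonempty u) hs
      exact hab.2.1 h₁
  have hsub : ∀ w, f w ⊆ if v ∈ f w then insert u (f w) else f w := by
    intro w
    split_ifs
    exacts [Set.subset_insert _ _, subset_rfl]
  refine ⟨fun w => if v ∈ f w then insert u (f w) else f w,
    fun w => ⟨(hf w).1.mono (hsub w), ?_⟩, fun w₁ w₂ hne => ?_, fun w₁ w₂ hw => ?_⟩
  · refine induce_connected_of_forall_cut ((hf w).1.mono (hsub w)) fun t hts ht hne => ?_
    dsimp only at hts hne ⊢
    by_cases hv : v ∈ f w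
    · rw [if_pos hv] at hts hne ⊢
      by_cases h₁ : (t \ {u}).Nonempty
      · by_cases h₂ : t \ {u} = f w
        · have hut : u ∉ t := fun hut => hne <| by
            rw [← h₂, Set.insert_sdiff_singleton, Set.insert_eq_of_mem hut]
          have hvt : v ∈ t := by rw [← h₂] at hv; exact hv.1
          exact ⟨v, hvt, u, Set.mem_insert _ _, hut, huv.symm⟩
        · obtain ⟨a, hat, b, hb, hbt, -, hau, hbu, hab⟩ := exists_adj_of_induce_connected (hf w).2
            (t := t \ {u}) (fun a ha => (hts ha.1).resolve_left ha.2) h₁ h₂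
          have hbt' : b ∉ t := fun h => hbt ⟨h, hbu⟩
          rcases hab with hab | ⟨rfl, hab⟩ | ⟨rfl, hab⟩
          · exact ⟨a, hat.1, b, Or.inr hb, hbt', hab⟩
          · by_cases hut : u ∈ t
            · exact ⟨u, hut, b, Or.inr hb, hbt', hab⟩
            · exact ⟨a, hat.1, u, Or.inl rfl, hut, huv.symm⟩
          · by_cases hut : u ∈ t
            · exact ⟨u, hut, b, Or.inr hb, hbt', huv⟩
            · exact ⟨a, hat.1, u, Or.inl rfl, hut, hab⟩
      · rw [Set.not_nonempty_iff_eq_empty, Set.sdiff_eq_empty] at h₁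
        obtain rfl : t = {u} := h₁.antisymm (Set.singleton_subset_iff.2 (by
          obtain ⟨a, hat⟩ := ht
          exact h₁ hat ▸ hat))
        exact ⟨u, rfl, v, Or.inr hv, huv.ne', huv⟩
    · rw [if_neg hv] at hts hne ⊢
      obtain ⟨a, hat, b, hb, hbt, -, hau, hbu, hab⟩ :=
        exists_adj_of_induce_connected (hf w).2 hts ht hne
      refine ⟨a, hat, b, hb, hbt, ?_⟩
      rcases hab with hab | ⟨rfl, hab⟩ | ⟨rfl, hab⟩
      exacts [hab, absurd (hts hat) hv, absurd hb hv]
  · have hdis := Set.disjoint_left.1 (hd w₁ w₂ hne)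
    have h₁ := hu w₁
    have h₂ := hu w₂
    refine Set.disjoint_left.2 fun a => ?_
    dsimp only
    split_ifs with h₃ h₄ h₄
    · exact absurd h₄ (hdis h₃)
    · rintro (rfl | h)
      exacts [h₂, hdis h]
    · rintro h (rfl | h')
      exacts [h₁ h, hdis h h']
    · exact @hdis a
  · obtain ⟨a, h₁, b, h₂, -, -, -, hab⟩ := ha w₁ w₂ hw
    rcases hab with hab | ⟨rfl, hab⟩ | ⟨rfl, hab⟩
    · exact ⟨a, hsub w₁ h₁, b, hsub w₂ h₂, hab⟩
    · exact ⟨u, by simp [h₁], b, hsub w₂ h₂, hab⟩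
    · exact ⟨a, hsub w₁ h₁, u, by simp [h₂], hab⟩

theorem hasMinor_completeGraph_five {a b c d : V} {s : Set V} (hs : (G.induce s).Connected)
    (ha : a ∉ s) (hb : b ∉ s) (hc : c ∉ s) (hd : d ∉ s) (hab : G.Adj a b) (hac : G.Adj a c)
    (had : G.Adj a d) (hbc : G.Adj b c) (hbd : G.Adj b d) (hcd : G.Adj c d)
    (has : ∃ x ∈ s, G.Adj a x) (hbs : ∃ x ∈ s, G.Adj b x) (hcs : ∃ x ∈ s, G.Adj c x)
    (hds : ∃ x ∈ s, G.Adj d x) : HasMinor G (completeGraph (Fin 5)) := by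
  have hsn : s.Nonempty := let ⟨x, hx, _⟩ := has; ⟨x, hx⟩
  have key : ∀ i j : Fin 5, i < j →
      Disjoint (![{a}, {b}, {c}, {d}, s] i : Set V) (![{a}, {b}, {c}, {d}, s] j) ∧
      ∃ v₁ ∈ (![{a}, {b}, {c}, {d}, s] i : Set V), ∃ v₂ ∈ (![{a}, {b}, {c}, {d}, s] j : Set V),
        G.Adj v₁ v₂ := by
    simp [Fin.forall_fin_succ, *, hab.ne', hac.ne', had.ne', hbc.ne', hbd.ne', hcd.ne']
  refine ⟨![{a}, {b}, {c}, {d}, s], fun i => ?_, fun i j hij => ?_, fun i j hij => ?_⟩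
  · fin_cases i <;> simp [hsn, hs, connected_iff_exists_forall_reachable]
  · rcases lt_or_gt_of_ne hij with h | h
    exacts [(key i j h).1, (key j i h).1.symm]
  · rcases lt_or_gt_of_ne hij.ne with h | h
    · exact (key i j h).2
    · obtain ⟨v₁, h₁, v₂, h₂, h₃⟩ := (key j i h).2
      exact ⟨v₂, h₂, v₁, h₁, h₃.symm⟩

theorem hasMinor_completeBipartiteGraph_three_three {a b x y z : V} {s : Set V}
    (hs : (G.induce s).Connected) (ha : a ∉ s) (hb : b ∉ s) (hx : x ∉ s) (hy : y ∉ s)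
    (hz : z ∉ s) (hab : a ≠ b) (hxy : x ≠ y) (hxz : x ≠ z) (hyz : y ≠ z)
    (hax : G.Adj a x) (hay : G.Adj a y) (haz : G.Adj a z) (hbx : G.Adj b x) (hby : G.Adj b y)
    (hbz : G.Adj b z) (hsx : ∃ t ∈ s, G.Adj t x) (hsy : ∃ t ∈ s, G.Adj t y)
    (hsz : ∃ t ∈ s, G.Adj t z) :
    HasMinor G (completeBipartiteGraph (Fin 3) (Fin 3)) := by
  have hsn : s.Nonempty := let ⟨x, hx, _⟩ := hsx; ⟨x, hx⟩
  have key : ∀ i j : Fin 3,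
      Disjoint (![{a}, {b}, s] i : Set V) (![{x}, {y}, {z}] j) ∧
      ∃ v₁ ∈ (![{a}, {b}, s] i : Set V), ∃ v₂ ∈ (![{x}, {y}, {z}] j : Set V),
        G.Adj v₁ v₂ := by
    simp [Fin.forall_fin_succ, *, hax.ne', hay.ne', haz.ne', hbx.ne', hby.ne', hbz.ne']
  have k₁ : ∀ i j : Fin 3, i ≠ j → Disjoint (![{a}, {b}, s] i : Set V) (![{a}, {b}, s] j) := by
    simp [Fin.forall_fin_succ, *, hab.symm]
  have k₂ : ∀ i j : Fin 3, i ≠ j →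
      Disjoint (![{x}, {y}, {z}] i : Set V) (![{x}, {y}, {z}] j) := by
    simp [Fin.forall_fin_succ, *, hxy.symm, hxz.symm, hyz.symm]
  refine ⟨Sum.elim ![{a}, {b}, s] ![{x}, {y}, {z}], ?_, ?_, ?_⟩
  · rintro (i | i) <;> fin_cases i <;>
      simp [hsn, hs, connected_iff_exists_forall_reachable]
  · rintro (i | i) (j | j) hij
    · exact k₁ i j (by simpa using hij)
    · exact (key i j).1
    · exact (key j i).1.symm
    · exact k₂ i j (by simpa using hij)
  · rintro (i | i) (j | j) hij
    · simp at hij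
    · exact (key i j).2
    · obtain ⟨v₁, h₁, v₂, h₂, h₃⟩ := (key j i).2
      exact ⟨v₂, h₂, v₁, h₁, h₃.symm⟩
    · simp at hij

end Minor

section Count

open scoped Classical

/-- The number of neighbours of `a` in `S`. -/
noncomputable def degIn (G : SimpleGraph V) (S : Finset V) (a : V) : ℕ :=
  (S.filter (G.Adj a)).card

/-- The sum of the degrees in the subgraph induced by `S`. -/
noncomputable def degSum (G : SimpleGraph V) (S : Finset V) : ℕ :=
  ∑ a ∈ S, degIn G S a

variable {G H : SimpleGraph V} {S : Finset V}

theorem degSum_eq_card (G : SimpleGraph V) (S : Finset V) :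
    degSum G S = ((S ×ˢ S).filter fun p => G.Adj p.1 p.2).card := by
  simp only [degSum, degIn, Finset.card_filter, Finset.sum_product]

theorem degSum_mono_left (h : ∀ a ∈ S, ∀ b ∈ S, G.Adj a b → H.Adj a b) :
    degSum G S ≤ degSum H S := by
  rw [degSum_eq_card, degSum_eq_card]
  refine Finset.card_le_card fun p hp => ?_
  simp only [Finset.mem_filter, Finset.mem_product] at hp ⊢
  exact ⟨hp.1, h _ hp.1.1 _ hp.1.2 hp.2⟩

theorem degIn_erase_self (G : SimpleGraph V) (S : Finset V) (u : V) :
    degIn G (S.erase u) u = degIn G S u := by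
  unfold degIn
  congr 1
  ext b
  simp only [Finset.mem_filter, Finset.mem_erase]
  exact ⟨fun h => ⟨h.1.2, h.2⟩, fun h => ⟨⟨h.2.ne', h.1⟩, h.2⟩⟩

theorem degIn_erase_add {u a : V} (hu : u ∈ S) :
    degIn G (S.erase u) a + (if G.Adj a u then 1 else 0) = degIn G S a := by
  unfold degIn
  rw [Finset.filter_erase]
  split_ifs with h
  · exact Finset.card_erase_add_one (by simp [hu, h])
  · rw [Finset.erase_eq_of_notMem (by simp [h]), add_zero]

theorem degSum_eq_erase_add {u : V} (hu : u ∈ S) :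
    degSum G S = degSum G (S.erase u) + 2 * degIn G S u := by
  rw [degSum, ← Finset.sum_erase_add _ _ hu, degSum]
  have h : ∑ a ∈ S.erase u, degIn G S a =
      ∑ a ∈ S.erase u, degIn G (S.erase u) a + degIn G (S.erase u) u := by
    rw [degIn, Finset.card_filter, ← Finset.sum_add_distrib]
    refine Finset.sum_congr rfl fun a _ => ?_
    rw [← degIn_erase_add hu]
    simp only [G.adj_comm a u]
  rw [h, degIn_erase_self]
  ring

theorem degSum_le_mergeInto {u v : V} (huv : u ≠ v) (hu : u ∈ S) (hv : v ∈ S) :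
    degSum G S ≤ degSum (mergeInto G u v) (S.erase u) +
      2 * (S.filter fun a => G.Adj u a ∧ G.Adj v a).card + (if G.Adj u v then 2 else 0) := by
  have hv' : v ∈ S.erase u := Finset.mem_erase.2 ⟨huv.symm, hv⟩
  rw [degSum_eq_erase_add hu, degSum_eq_erase_add hv',
    degSum_eq_erase_add (G := mergeInto G u v) hv']
  have h₁ : degSum G ((S.erase u).erase v) ≤ degSum (mergeInto G u v) ((S.erase u).erase v) := by
    refine degSum_mono_left fun a ha b hb hab => ?_
    simp only [Finset.mem_erase] at ha hb
    exact ⟨hab.ne, ha.2.1, hb.2.1, Or.inl hab⟩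
  have h₂ := degIn_erase_add (G := G) (a := u) hv
  have h₃ : degIn G (S.erase u) v + degIn G (S.erase v) u ≤
      degIn (mergeInto G u v) (S.erase u) v +
        (S.filter fun a => G.Adj u a ∧ G.Adj v a).card := by
    unfold degIn
    rw [← Finset.card_union_add_card_inter]
    refine Nat.add_le_add (Finset.card_le_card fun b hb => ?_)
      (Finset.card_le_card fun b hb => ?_)
    · simp only [Finset.mem_union, Finset.mem_filter, Finset.mem_erase] at hb ⊢
      rcases hb with ⟨⟨h₄, h₅⟩, h₆⟩ | ⟨⟨h₄, h₅⟩, h₆⟩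
      · exact ⟨⟨h₄, h₅⟩, h₆.ne, huv.symm, h₄, Or.inl h₆⟩
      · exact ⟨⟨h₆.ne', h₅⟩, Ne.symm h₄, huv.symm, h₆.ne', Or.inr (Or.inl ⟨rfl, h₆⟩)⟩
    · simp only [Finset.mem_inter, Finset.mem_filter, Finset.mem_erase] at hb ⊢
      exact ⟨hb.1.1.2, hb.2.2, hb.1.2⟩
  split_ifs at h₂ ⊢ <;> omega

theorem exists_le_degSum (G : SimpleGraph V) (S : Finset V) {m : ℕ} (hm : m ≤ degSum G S) :
    ∃ H ≤ G, m ≤ degSum H S ∧ degSum H S ≤ m + 1 := by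
  induction h : degSum G S using Nat.strong_induction_on generalizing G with
  | _ t ih =>
    by_cases ht : t ≤ m + 1
    · exact ⟨G, le_rfl, hm, h.trans_le ht⟩
    have hpos : 0 < degSum G S := by omega
    rw [degSum_eq_card, Finset.card_pos] at hpos
    obtain ⟨⟨a, b⟩, hp⟩ := hpos
    simp only [Finset.mem_filter, Finset.mem_product] at hp
    set G' := G.deleteEdges {s(a, b)} with hG'
    have hle : G' ≤ G := deleteEdges_le _
    have h₁ : degSum G S ≤ degSum G' S + 2 := by
      rw [degSum_eq_card, degSum_eq_card]
      have h₃ : ({(a, b), (b, a)} : Finset (V × V)).card ≤ 2 :=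
        card_le_two_of_forall (c := (a, b)) (d := (b, a)) (by simp)
      refine (Finset.card_le_card fun p hp' => ?_).trans ((Finset.card_union_le _ _).trans
        (Nat.add_le_add_left h₃ _))
      obtain ⟨c, d⟩ := p
      simp only [Finset.mem_filter, Finset.mem_product, Finset.mem_union, Finset.mem_insert,
        Finset.mem_singleton, hG', deleteEdges_adj, Set.mem_singleton_iff, Sym2.eq_iff,
        Prod.mk.injEq] at hp' ⊢
      tauto
    have h₂ : degSum G' S < degSum G S := by
      rw [degSum_eq_card, degSum_eq_card]
      refine Finset.card_lt_card ((Finset.ssubset_iff_of_subset ?_).2 ⟨(a, b), ?_, ?_⟩)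
      · intro p hp'
        simp only [Finset.mem_filter] at hp' ⊢
        exact ⟨hp'.1, hle hp'.2⟩
      · simp [hp]
      · simp [hG']
    obtain ⟨H, hH, h₃⟩ := ih _ (h ▸ h₂) G' (by omega) rfl
    exact ⟨H, hH.trans hle, h₃⟩

theorem exists_degIn_lt {d : ℕ} (h : degSum G S < d * S.card) : ∃ v ∈ S, degIn G S v < d := by
  by_contra! hcon
  have := Finset.card_nsmul_le_sum S _ _ hcon
  rw [smul_eq_mul, mul_comm] at this
  exact absurd h (not_lt.2 this)

/-- A separation of an induced subgraph. -/
theorem degSum_add_inter_le {S₁ S₂ : Finset V} (hS : S = S₁ ∪ S₂)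
    (h : ∀ a ∈ S₁, a ∉ S₂ → ∀ b ∈ S₂, b ∉ S₁ → ¬ G.Adj a b) :
    degSum G S + degSum G (S₁ ∩ S₂) ≤ degSum G S₁ + degSum G S₂ := by
  subst hS
  simp only [degSum_eq_card]
  rw [← Finset.card_union_add_card_inter ((S₁ ×ˢ S₁).filter fun p => G.Adj p.1 p.2)]
  refine Nat.add_le_add (Finset.card_le_card fun p hp => ?_) (Finset.card_le_card fun p hp => ?_)
  · simp only [Finset.mem_filter, Finset.mem_product, Finset.mem_union] at hp ⊢
    have h₁ := h p.1
    have h₂ := h p.2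
    have := hp.2.symm
    grind
  · simp only [Finset.mem_filter, Finset.mem_product, Finset.mem_inter] at hp ⊢
    tauto

end Count

section EdgeBound

open scoped Classical

variable {G : SimpleGraph V} {S : Finset V}

theorem degIn_le_card {T : Finset V} {a : V} (h : ∀ b ∈ S, G.Adj a b → b ∈ T) :
    degIn G S a ≤ T.card := by
  refine Finset.card_le_card fun b hb => ?_
  rw [Finset.mem_filter] at hb
  exact h b hb.1 hb.2

theorem degSum_eq_zero_of_card_le_one (h : S.card ≤ 1) : degSum G S = 0 := by
  refine Finset.sum_eq_zero fun a ha => ?_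
  rw [degIn, Finset.card_eq_zero, Finset.filter_eq_empty_iff]
  intro b hb hab
  exact hab.ne (Finset.card_le_one.1 h a ha b hb)

/-- A vertex with a dense neighbourhood of at most five vertices gives a `K₅` minor. -/
theorem hasMinor_completeGraph_five_of_dense_neighbors {v : V} {D : Finset V}
    (hv : ∀ w ∈ D, G.Adj v w) (h₄ : 4 ≤ D.card) (h₅ : D.card ≤ 5)
    (hD : ∀ w ∈ D, 3 ≤ degIn G D w) : HasMinor G (completeGraph (Fin 5)) := by
  by_cases hcl : ∀ a ∈ D, ∀ b ∈ D, a ≠ b → G.Adj a b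
  · have hnd := D.nodup_toList
    have hlen := D.length_toList
    have hmem : ∀ a, a ∈ D.toList → a ∈ D := fun a => D.mem_toList.1
    match h : D.toList, hlen with
    | [], h' | [_], h' | [_, _], h' | [_, _, _], h' => simp at h'; omega
    | a :: b :: c :: d :: l, _ =>
      rw [h] at hnd hmem
      simp only [List.nodup_cons, List.mem_cons, not_or] at hnd
      have ha := hmem a (by simp)
      have hb := hmem b (by simp)
      have hc := hmem c (by simp)
      have hd := hmem d (by simp)
      obtain ⟨⟨hab, hac, had, -⟩, ⟨hbc, hbd, -⟩, ⟨hcd, -⟩, -⟩ := hnd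
      refine hasMinor_completeGraph_five (a := v) (b := a) (c := b) (d := c) (s := {d})
        (by simp [connected_iff_exists_forall_reachable]) ?_ ?_ ?_ ?_ ?_ ?_ ?_ ?_ ?_ ?_ ?_ ?_ ?_ ?_
      all_goals simp_all only [Set.mem_singleton_iff, ne_eq, not_false_eq_true, exists_eq_left]
      exact (hv d hd).ne
  · push Not at hcl
    obtain ⟨a, ha, b, hb, hab, hnadj⟩ := hcl
    have hsub : ∀ c ∈ ({a, b} : Finset V), ∀ d ∈ D, G.Adj c d → d ∈ (D.erase a).erase b := by
      intro c hc d hd hcd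
      have := hcd.ne
      have := fun h => hnadj (G.adj_symm h)
      simp only [Finset.mem_insert, Finset.mem_singleton, Finset.mem_erase] at hc ⊢
      grind
    have hba : b ∈ D.erase a := by simp [hb, hab.symm]
    have hcard : ((D.erase a).erase b).card = D.card - 2 := by
      rw [Finset.card_erase_of_mem hba, Finset.card_erase_of_mem ha]
      omega
    have hle := (hD a ha).trans (degIn_le_card (hsub a (by simp)))
    have hE : ∀ c ∈ ({a, b} : Finset V), ∀ d ∈ (D.erase a).erase b, G.Adj c d := by
      intro c hc d hd
      have hcD : c ∈ D := by
        rcases Finset.mem_insert.1 hc with rfl | hc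
        exacts [ha, Finset.mem_singleton.1 hc ▸ hb]
      by_contra hcd
      have h₁ := (hD c hcD).trans (degIn_le_card (T := ((D.erase a).erase b).erase d)
        fun e he hce => Finset.mem_erase.2 ⟨fun h => hcd (h ▸ hce), hsub c hc e he hce⟩)
      rw [Finset.card_erase_of_mem hd] at h₁
      omega
    obtain ⟨p, q, r, hpq, hpr, hqr, hpqr⟩ := Finset.card_eq_three.1
      (show ((D.erase a).erase b).card = 3 by omega)
    have hDmem : ∀ c ∈ D, c = a ∨ c = b ∨ c = p ∨ c = q ∨ c = r := by
      intro c hc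
      by_cases h₁ : c = a
      · exact Or.inl h₁
      by_cases h₂ : c = b
      · exact Or.inr (Or.inl h₂)
      have : c ∈ (D.erase a).erase b :=
        Finset.mem_erase.2 ⟨h₂, Finset.mem_erase.2 ⟨h₁, hc⟩⟩
      rw [hpqr] at this
      simpa [h₁, h₂] using this
    have hmem : ∀ c, c = p ∨ c = q ∨ c = r → c ≠ a ∧ c ≠ b ∧ c ∈ D ∧ G.Adj a c ∧ G.Adj b c := by
      intro c hc
      have hc' : c ∈ (D.erase a).erase b := by rw [hpqr]; simpa using hc
      have h₁ := hE a (by simp) c hc'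
      have h₂ := hE b (by simp) c hc'
      simp only [Finset.mem_erase] at hc'
      exact ⟨hc'.2.1, hc'.1, hc'.2.2, h₁, h₂⟩
    have htri : ∀ c, c = p ∨ c = q ∨ c = r → ∃ d, (d = p ∨ d = q ∨ d = r) ∧ G.Adj c d := by
      intro c hc
      by_contra! hcon
      have h₁ := (hD c (hmem c hc).2.2.1).trans (degIn_le_card (T := {a, b}) fun e he hce => by
        simp only [Finset.mem_insert, Finset.mem_singleton]
        have := hDmem e he
        have := fun h => hcon e h hce
        tauto)
      exact absurd (h₁.trans (card_le_two_of_forall (c := a) (d := b) (by simp))) (by simp)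
    have key : ∀ p q r : V, p ≠ q → p ≠ r → q ≠ r →
        (∀ c, c = p ∨ c = q ∨ c = r → c ≠ a ∧ c ≠ b ∧ c ∈ D ∧ G.Adj a c ∧ G.Adj b c) →
        G.Adj p q → G.Adj p r → HasMinor G (completeGraph (Fin 5)) := by
      intro p q r hpq hpr hqr hmem hadj₁ hadj₂
      obtain ⟨hpa, hpb, hpD, hap, hbp⟩ := hmem p (by simp)
      obtain ⟨hqa, hqb, hqD, haq, hbq⟩ := hmem q (by simp)
      obtain ⟨hra, hrb, hrD, har, hbr⟩ := hmem r (by simp)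
      refine hasMinor_completeGraph_five (a := v) (b := p) (c := a) (d := r) (s := {b, q}) ?_
        ?_ ?_ ?_ ?_ (hv p hpD) (hv a ha) (hv r hrD) hap.symm hadj₂ har ⟨b, by simp, hv b hb⟩
        ⟨b, by simp, hbp.symm⟩ ⟨q, by simp, haq⟩ ⟨b, by simp, hbr.symm⟩
      · exact induce_pair_connected_of_adj hbq
      · simp [(hv b hb).ne, (hv q hqD).ne]
      · simp [hpb, hpq]
      · simp [hab, hqa.symm]
      · simp [hrb, hqr.symm]
    obtain ⟨p', hp', hp⟩ := htri p (by simp)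
    obtain ⟨q', hq', hq⟩ := htri q (by simp)
    obtain ⟨r', hr', hr⟩ := htri r (by simp)
    have hpath : G.Adj p q ∧ G.Adj p r ∨ G.Adj q p ∧ G.Adj q r ∨ G.Adj r p ∧ G.Adj r q := by
      have h₁ := G.adj_comm p q
      have h₂ := G.adj_comm p r
      have h₃ := G.adj_comm q r
      have := hp.ne
      have := hq.ne
      have := hr.ne
      grind
    rcases hpath with h | h | h
    · exact key p q r hpq hpr hqr hmem h.1 h.2
    · exact key q p r hpq.symm hqr hpr (fun c hc => hmem c (by grind)) h.1 h.2
    · exact key r p q hpr.symm hqr.symm hpq (fun c hc => hmem c (by grind)) h.1 h.2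

theorem degSum_add_six_le (hG : ¬ HasMinor G (completeGraph (Fin 5))) (hS : S.Nonempty) :
    degSum G S + 6 ≤ 6 * S.card := by
  induction hn : S.card using Nat.strong_induction_on generalizing G S with
  | _ n ih =>
  subst hn
  by_contra! hcon
  have hpos := hS.card_pos
  obtain ⟨H, hHG, hH₁, hH₂⟩ := exists_le_degSum G S (m := 6 * S.card - 5) (by omega)
  replace hG : ¬ HasMinor H (completeGraph (Fin 5)) := fun h => hG (h.mono hHG)
  obtain ⟨v, hv, hdeg⟩ := exists_degIn_lt (G := H) (S := S) (d := 6) (by omega)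
  have hS₂ : 2 ≤ S.card := by
    by_contra hlt
    have := degSum_eq_zero_of_card_le_one (G := H) (S := S) (by omega)
    omega
  have hd₄ : 4 ≤ degIn H S v := by
    have hc := Finset.card_erase_of_mem hv
    have h₁ := ih _ (by omega) hG (S := S.erase v) (Finset.card_pos.1 (by omega)) rfl
    have h₂ := degSum_eq_erase_add (G := H) hv
    omega
  refine hG (hasMinor_completeGraph_five_of_dense_neighbors (v := v) (D := S.filter (H.Adj v))
    (by simp) hd₄ (by unfold degIn at hdeg; omega) fun w hw => ?_)
  obtain ⟨hwS, hvw⟩ := Finset.mem_filter.1 hw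
  have hc := Finset.card_erase_of_mem hwS
  have hmerge : ¬ HasMinor (mergeInto H w v) (completeGraph (Fin 5)) := by
    refine fun h => hG (h.of_mergeInto hvw.symm fun i => ?_)
    obtain ⟨j, hj⟩ := exists_ne i
    exact ⟨j, by simpa using hj.symm⟩
  have h₁ := ih (S.erase w).card (by omega) hmerge (Finset.card_pos.1 (by omega)) rfl
  have h₂ := degSum_le_mergeInto (G := H) hvw.ne' hwS hv
  rw [if_pos hvw.symm] at h₂
  have h₃ : degIn H (S.filter (H.Adj v)) w =
      (S.filter fun a => H.Adj w a ∧ H.Adj v a).card := by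
    rw [degIn, Finset.filter_filter]
    simp only [and_comm]
  omega

end EdgeBound

section BipartiteEdgeBound

open scoped Classical

variable {G : SimpleGraph V} {S : Finset V} {p : V → Prop}

theorem mergeInto_mono {H : SimpleGraph V} (hle : G ≤ H) (u v : V) :
    mergeInto G u v ≤ mergeInto H u v := by
  rintro a b ⟨h₁, h₂, h₃, h₄⟩
  refine ⟨h₁, h₂, h₃, ?_⟩
  rcases h₄ with h | ⟨h, h'⟩ | ⟨h, h'⟩
  exacts [Or.inl (hle h), Or.inr (Or.inl ⟨h, hle h'⟩), Or.inr (Or.inr ⟨h, hle h'⟩)]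

theorem card_le_degIn {T : Finset V} {a : V} (h : ∀ b ∈ T, b ∈ S ∧ G.Adj a b) :
    T.card ≤ degIn G S a :=
  Finset.card_le_card fun b hb => Finset.mem_filter.2 (h b hb)

theorem degSum_le_four_of_card_eq_three (hp : ∀ a b, G.Adj a b → (p a ↔ ¬ p b))
    (hS : S.card = 3) : degSum G S ≤ 4 := by
  obtain ⟨a, b, c, hab, hac, hbc, rfl⟩ := Finset.card_eq_three.1 hS
  have key : ∀ a b c : V, a ≠ b → a ≠ c → b ≠ c → ¬ G.Adj a b → degSum G {a, b, c} ≤ 4 := by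
    intro a b c hab hac hbc hadj
    have hc : c ∈ ({a, b, c} : Finset V) := by simp
    have hS : ({a, b, c} : Finset V).erase c = {a, b} := by
      ext x
      simp only [Finset.mem_erase, Finset.mem_insert, Finset.mem_singleton]
      grind
    rw [degSum_eq_erase_add hc, ← degIn_erase_self, hS]
    have h₁ : degSum G {a, b} = 0 := by
      refine Finset.sum_eq_zero fun x hx => ?_
      rw [degIn, Finset.card_eq_zero, Finset.filter_eq_empty_iff]
      intro y hy hxy
      have := hxy.ne
      have := hxy.symm
      simp only [Finset.mem_insert, Finset.mem_singleton] at hx hy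
      grind
    have h₂ : degIn G {a, b} c ≤ 2 :=
      (Finset.card_filter_le _ _).trans (card_le_two_of_forall (c := a) (d := b) (by simp))
    omega
  have h₁ := hp a b
  have h₂ := hp a c
  have h₃ := hp b c
  by_cases h : G.Adj a b
  · by_cases h' : G.Adj a c
    · rw [show ({a, b, c} : Finset V) = {b, c, a} by ext; simp; tauto]
      exact key b c a hbc hab.symm hac.symm (by tauto)
    · rw [show ({a, b, c} : Finset V) = {a, c, b} by ext; simp; tauto]
      exact key a c b hac hab hbc.symm h'
  · exact key a b c hab hac hbc h

set_option maxHeartbeats 800000 in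
theorem degSum_add_eight_le (hp : ∀ a b, G.Adj a b → (p a ↔ ¬ p b))
    (hG : ¬ HasMinor G (completeBipartiteGraph (Fin 3) (Fin 3))) (hS : 3 ≤ S.card) :
    degSum G S + 8 ≤ 4 * S.card := by
  induction hn : S.card using Nat.strong_induction_on generalizing G S with
  | _ n ih =>
  subst hn
  by_contra! hcon
  obtain ⟨H, hHG, hH₁, hH₂⟩ := exists_le_degSum G S (m := 4 * S.card - 7) (by omega)
  replace hG : ¬ HasMinor H (completeBipartiteGraph (Fin 3) (Fin 3)) := fun h => hG (h.mono hHG)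
  replace hp : ∀ a b, H.Adj a b → (p a ↔ ¬ p b) := fun a b h => hp a b (hHG h)
  obtain ⟨l, hl, hdeg⟩ := exists_degIn_lt (G := H) (S := S) (d := 4) (by omega)
  have hS₄ : 4 ≤ S.card := by
    by_contra hlt
    have := degSum_le_four_of_card_eq_three (S := S) hp (by omega)
    omega
  have hmin : ∀ w ∈ S, 3 ≤ degIn H S w := by
    intro w hw
    have hc := Finset.card_erase_of_mem hw
    have h₁ := ih (S.erase w).card (by omega) hp hG (by omega) rfl
    have h₂ := degSum_eq_erase_add (G := H) hw
    omega
  obtain ⟨h₁, h₂, h₃, h₁₂, h₁₃, h₂₃, hN⟩ := Finset.card_eq_three.1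
    (show (S.filter (H.Adj l)).card = 3 from le_antisymm (Nat.lt_succ_iff.1 hdeg) (hmin l hl))
  have hNmem : ∀ a, a = h₁ ∨ a = h₂ ∨ a = h₃ → a ∈ S ∧ H.Adj l a := fun a ha => by
    have : a ∈ S.filter (H.Adj l) := by rw [hN]; simpa using ha
    simpa using this
  obtain ⟨hS₁, hl₁⟩ := hNmem h₁ (by simp)
  obtain ⟨hS₂, hl₂⟩ := hNmem h₂ (by simp)
  obtain ⟨hS₃, hl₃⟩ := hNmem h₃ (by simp)
  have p₁ := hp _ _ hl₁
  have p₂ := hp _ _ hl₂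
  have p₃ := hp _ _ hl₃
  have hn₁₂ : ¬ H.Adj h₁ h₂ := fun h => by have := hp _ _ h; tauto
  have hn₁₃ : ¬ H.Adj h₁ h₃ := fun h => by have := hp _ _ h; tauto
  set C := S.filter fun a => H.Adj h₂ a ∧ H.Adj h₁ a with hC
  have hlC : l ∈ C := by simp [hC, hl, hl₁.symm, hl₂.symm]
  by_cases hC₂ : C.card ≤ 2
  · have hS₅ : 5 ≤ S.card := by
      have h₂' : h₂ ∈ S.erase h₁ := Finset.mem_erase.2 ⟨h₁₂.symm, hS₂⟩
      have := (hmin h₁ hS₁).trans (degIn_le_card (T := (S.erase h₁).erase h₂) fun b hb hab =>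
        Finset.mem_erase.2 ⟨fun h => hn₁₂ (h ▸ hab), Finset.mem_erase.2 ⟨hab.ne', hb⟩⟩)
      rw [Finset.card_erase_of_mem h₂', Finset.card_erase_of_mem hS₁] at this
      omega
    have hS₁' : h₁ ∈ S.erase l := Finset.mem_erase.2 ⟨hl₁.ne', hS₁⟩
    have hS₂' : h₂ ∈ S.erase l := Finset.mem_erase.2 ⟨hl₂.ne', hS₂⟩
    have hc₁ := Finset.card_erase_of_mem hl
    have hc₂ := Finset.card_erase_of_mem hS₂'
    obtain ⟨L, hL⟩ : ∃ L : SimpleGraph V, ∀ a b, L.Adj a b ↔ H.Adj a b ∧ a ≠ l ∧ b ≠ l :=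
      ⟨H.deleteIncidenceSet l, fun _ _ => deleteIncidenceSet_adj⟩
    have hLH : L ≤ H := fun a b h => ((hL a b).1 h).1
    have hbip : ∀ a b, (mergeInto L h₂ h₁).Adj a b → (p a ↔ ¬ p b) := by
      rintro a b ⟨-, -, -, h | ⟨rfl, h⟩ | ⟨rfl, h⟩⟩
      · exact hp _ _ (hLH h)
      · have := hp _ _ (hLH h); tauto
      · have := hp _ _ (hLH h); tauto
    have hminor : ¬ HasMinor (mergeInto L h₂ h₁) (completeBipartiteGraph (Fin 3) (Fin 3)) := by
      intro h
      have hK : ∀ w : Fin 3 ⊕ Fin 3, ∃ w', (completeBipartiteGraph (Fin 3) (Fin 3)).Adj w w' := by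
        rintro (i | i)
        exacts [⟨Sum.inr 0, by simp⟩, ⟨Sum.inl 0, by simp⟩]
      have hLM : L ≤ mergeInto H l h₁ := by
        intro a b hab
        rw [hL] at hab
        exact ⟨hab.1.ne, hab.2.1, hab.2.2, Or.inl hab.1⟩
      refine hG (HasMinor.of_mergeInto hl₁ hK (HasMinor.of_mergeInto (u := h₂) (v := h₁) ?_ hK
        (h.mono (mergeInto_mono hLM h₂ h₁))))
      exact ⟨h₁₂.symm, hl₂.ne', hl₁.ne', Or.inr (Or.inr ⟨rfl, hl₂.symm⟩)⟩
    have e₁ := ih ((S.erase l).erase h₂).card (by omega) hbip hminor (by omega) rfl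
    have e₂ := degSum_eq_erase_add (G := H) hl
    have e₃ : degSum H (S.erase l) ≤ degSum L (S.erase l) := by
      refine degSum_mono_left fun a ha b hb hab => ?_
      rw [hL]
      exact ⟨hab, Finset.ne_of_mem_erase ha, Finset.ne_of_mem_erase hb⟩
    have e₄ := degSum_le_mergeInto (G := L) h₁₂.symm hS₂' hS₁'
    rw [if_neg fun h => hn₁₂ (hLH h).symm] at e₄
    have e₅ : ((S.erase l).filter fun a => L.Adj h₂ a ∧ L.Adj h₁ a).card ≤ (C.erase l).card := by
      refine Finset.card_le_card fun a ha => ?_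
      rw [Finset.mem_filter, Finset.mem_erase] at ha
      exact Finset.mem_erase.2 ⟨ha.1.1, Finset.mem_filter.2 ⟨ha.1.2, hLH ha.2.1, hLH ha.2.2⟩⟩
    rw [Finset.card_erase_of_mem hlC] at e₅
    omega
  · push Not at hC₂
    set R := S.filter fun a => a ≠ h₁ ∧ a ≠ h₂ ∧ a ∉ C with hR
    have hCmem : ∀ c ∈ C, c ∈ S ∧ H.Adj h₂ c ∧ H.Adj h₁ c := fun c hc => by
      simpa [hC] using hc
    have hCR : ∀ c ∈ C, ∃ r ∈ (R : Set V), H.Adj r c := by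
      intro c hc
      obtain ⟨hcS, hc₂, hc₁⟩ := hCmem c hc
      by_contra! hcon
      have := (hmin c hcS).trans (degIn_le_card (T := {h₁, h₂}) fun b hb hcb => by
        have hbR : b ∉ R := fun h => hcon b (by simpa using h) hcb.symm
        have hbC : b ∉ C := fun h => by
          have := hp _ _ (hCmem b h).2.2
          have := hp _ _ hc₁
          have := hp _ _ hcb
          tauto
        simp only [hR, Finset.mem_filter, not_and] at hbR
        simp only [Finset.mem_insert, Finset.mem_singleton]
        tauto)
      exact absurd (this.trans (card_le_two_of_forall (c := h₁) (d := h₂) (by simp))) (by simp)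
    have hCR' : ∀ c ∈ C, c ∉ R := fun c hc h => (Finset.mem_filter.1 h).2.2.2 hc
    have hRn : (R : Set V).Nonempty := let ⟨r, hr, _⟩ := hCR l hlC; ⟨r, hr⟩
    by_cases hcut : ∀ t ⊆ (R : Set V), t.Nonempty → t ≠ R →
        ∃ a ∈ t, ∃ b ∈ (R : Set V), b ∉ t ∧ H.Adj a b
    · obtain ⟨x, hx, y, hy, z, hz, hxy, hxz, hyz⟩ := Finset.two_lt_card.1 hC₂
      exact hG (hasMinor_completeBipartiteGraph_three_three (induce_connected_of_forall_cut hRn hcut)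
        (by simp [hR]) (by simp [hR]) (hCR' x hx) (hCR' y hy) (hCR' z hz) h₁₂ hxy hxz hyz
        (hCmem x hx).2.2 (hCmem y hy).2.2 (hCmem z hz).2.2 (hCmem x hx).2.1 (hCmem y hy).2.1
        (hCmem z hz).2.1 (hCR x hx) (hCR y hy) (hCR z hz))
    · push Not at hcut
      obtain ⟨t, htR, ⟨x, hxt⟩, htne, hcut⟩ := hcut
      obtain ⟨y, hyR, hyt⟩ := Set.exists_of_ssubset (htR.ssubset_of_ne htne)
      have hxR : x ∈ R := htR hxt
      have hyR : y ∈ R := hyR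
      set S₁ := S.filter fun a => a ∉ R ∨ a ∈ t with hS₁d
      set S₂ := S.filter fun a => a ∉ R ∨ a ∉ t with hS₂d
      have hlt₁ : S₁.card < S.card := Finset.card_lt_card (Finset.filter_ssubset.2
        ⟨y, (Finset.mem_filter.1 hyR).1, by simp [hyR, hyt]⟩)
      have hlt₂ : S₂.card < S.card := Finset.card_lt_card (Finset.filter_ssubset.2
        ⟨x, (Finset.mem_filter.1 hxR).1, by simp [hxR, hxt]⟩)
      have hCsub : ∀ c ∈ C, c ∈ S₁ ∩ S₂ := fun c hc => by
        simp [hS₁d, hS₂d, hCR' c hc, (hCmem c hc).1]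
      have hU : S = S₁ ∪ S₂ := by
        ext a
        simp only [hS₁d, hS₂d, Finset.mem_union, Finset.mem_filter]
        by_cases hat : a ∈ t <;> simpa [hat] using fun h _ => h
      have hI : S₁ ∩ S₂ ⊆ insert h₁ (insert h₂ C) := by
        intro a ha
        obtain ⟨ha₁, ha₂⟩ := Finset.mem_inter.1 ha
        obtain ⟨haS, ha₁⟩ := Finset.mem_filter.1 ha₁
        replace ha₂ := (Finset.mem_filter.1 ha₂).2
        by_contra hcon
        simp only [Finset.mem_insert, not_or] at hcon
        have haR : a ∈ R := Finset.mem_filter.2 ⟨haS, hcon⟩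
        exact ha₂.resolve_left (not_not_intro haR) (ha₁.resolve_left (not_not_intro haR))
      have hI' := (Finset.card_le_card hI).trans ((Finset.card_insert_le _ _).trans
        (Nat.succ_le_succ (Finset.card_insert_le _ _)))
      have hCc := Finset.card_le_card (show C ⊆ S₁ ∩ S₂ from hCsub)
      have i₁ := Finset.card_le_card (Finset.inter_subset_left (s₁ := S₁) (s₂ := S₂))
      have i₂ := Finset.card_le_card (Finset.inter_subset_right (s₁ := S₁) (s₂ := S₂))
      have e₁ := ih S₁.card hlt₁ hp hG (by omega) rfl
      have e₂ := ih S₂.card hlt₂ hp hG (by omega) rfl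
      have e₃ := degSum_add_inter_le (G := H) hU fun a ha ha' b hb hb' => by
        simp only [hS₁d, hS₂d, Finset.mem_filter, not_and, not_or, not_not] at ha ha' hb hb'
        exact hcut a (ha' ha.1).2 b (hb' hb.1).1 (hb' hb.1).2
      have e₄ := Finset.card_union_add_card_inter S₁ S₂
      rw [← hU] at e₄
      have m₁ : h₁ ∈ S₁ ∩ S₂ := by simp [hS₁d, hS₂d, hR, hS₁]
      have m₂ : h₂ ∈ (S₁ ∩ S₂).erase h₁ := by simp [hS₁d, hS₂d, hR, hS₂, h₁₂.symm]
      have e₅ := degSum_eq_erase_add (G := H) m₁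
      have e₆ := degSum_eq_erase_add (G := H) m₂
      have e₇ : C.card ≤ degIn H (S₁ ∩ S₂) h₁ := card_le_degIn fun c hc =>
        ⟨hCsub c hc, (hCmem c hc).2.2⟩
      have e₈ : C.card ≤ degIn H ((S₁ ∩ S₂).erase h₁) h₂ := card_le_degIn fun c hc =>
        ⟨Finset.mem_erase.2 ⟨(hCmem c hc).2.2.ne', hCsub c hc⟩, (hCmem c hc).2.1⟩
      omega

end BipartiteEdgeBound

section LightVertex

open scoped Classical

variable {G : SimpleGraph V} {S : Finset V}

theorem sum_card_neighbors_le (hG : ¬ HasMinor G (completeBipartiteGraph (Fin 3) (Fin 3)))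
    {A B : Finset V} (hAB : Disjoint A B) :
    ∑ a ∈ A, (B.filter (G.Adj a)).card ≤ 2 * (A.card + B.card) := by
  by_cases hn : 3 ≤ (A ∪ B).card
  · obtain ⟨H, hH⟩ : ∃ H : SimpleGraph V, ∀ a b, H.Adj a b ↔
        G.Adj a b ∧ (a ∈ A ∧ b ∈ B ∨ a ∈ B ∧ b ∈ A) :=
      ⟨{ Adj := fun a b => G.Adj a b ∧ (a ∈ A ∧ b ∈ B ∨ a ∈ B ∧ b ∈ A)
         symm.symm := fun a b h => ⟨h.1.symm, h.2.symm.imp And.symm And.symm⟩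
         loopless.irrefl := fun a h => h.1.ne rfl }, fun _ _ => Iff.rfl⟩
    have hdis := Finset.disjoint_left.1 hAB
    have h₁ := degSum_add_eight_le (G := H) (S := A ∪ B) (p := (· ∈ A))
      (fun a b h => by
        rcases (hH a b).1 h with ⟨-, ⟨h₁, h₂⟩ | ⟨h₁, h₂⟩⟩
        · exact iff_of_true h₁ fun h => hdis h h₂
        · exact iff_of_false (fun h => hdis h h₁) (not_not_intro h₂))
      (fun h => hG (h.mono fun a b h => ((hH a b).1 h).1)) hn
    rw [degSum, Finset.sum_union hAB, Finset.card_union_of_disjoint hAB] at h₁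
    have h₂ : ∑ a ∈ A, (B.filter (G.Adj a)).card ≤ ∑ a ∈ A, degIn H (A ∪ B) a :=
      Finset.sum_le_sum fun a ha => card_le_degIn fun b hb => by
        rw [Finset.mem_filter] at hb
        exact ⟨Finset.mem_union_right _ hb.1, (hH a b).2 ⟨hb.2, Or.inl ⟨ha, hb.1⟩⟩⟩
    have h₃ : ∑ b ∈ B, (A.filter fun a => G.Adj a b).card ≤ ∑ b ∈ B, degIn H (A ∪ B) b :=
      Finset.sum_le_sum fun b hb => card_le_degIn fun a ha => by
        rw [Finset.mem_filter] at ha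
        exact ⟨Finset.mem_union_left _ ha.1, (hH b a).2 ⟨ha.2.symm, Or.inr ⟨hb, ha.1⟩⟩⟩
    have h₄ : ∑ a ∈ A, (B.filter (G.Adj a)).card = ∑ b ∈ B, (A.filter fun a => G.Adj a b).card :=
      Finset.sum_card_bipartiteAbove_eq_sum_card_bipartiteBelow G.Adj
    omega
  · rw [Finset.card_union_of_disjoint hAB] at hn
    calc ∑ a ∈ A, (B.filter (G.Adj a)).card ≤ ∑ a ∈ A, B.card :=
          Finset.sum_le_sum fun a _ => Finset.card_filter_le _ _
      _ = A.card * B.card := by simp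
      _ ≤ 2 * (A.card + B.card) := by
          have : A.card ≤ 2 := by omega
          nlinarith

/-- The number of neighbours of `x` in `S` that have at least `t` neighbours in `S`. -/
noncomputable def numHeavy (G : SimpleGraph V) (S : Finset V) (t : ℕ) (x : V) : ℕ :=
  ((S.filter fun y => t ≤ degIn G S y).filter (G.Adj x)).card

theorem sum_numHeavy_sub_two_le (hG : ¬ HasMinor G (completeBipartiteGraph (Fin 3) (Fin 3)))
    {t : ℕ} (ht : 6 ≤ t) :
    ∑ x ∈ S.filter (fun x => degIn G S x < 6), (numHeavy G S t x - 2) ≤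
      2 * (S.filter fun y => t ≤ degIn G S y).card := by
  set A := (S.filter fun x => degIn G S x < 6).filter fun x => 2 ≤ numHeavy G S t x with hA
  set B := S.filter fun y => t ≤ degIn G S y with hB
  have hAB : Disjoint A B := by
    refine Finset.disjoint_left.2 fun a ha hb => ?_
    simp only [hA, hB, Finset.mem_filter] at ha hb
    omega
  have h₁ : ∑ x ∈ S.filter (fun x => degIn G S x < 6), (numHeavy G S t x - 2) =
      ∑ x ∈ A, (numHeavy G S t x - 2) := by
    refine (Finset.sum_subset (Finset.filter_subset _ _) fun x hx hxA => ?_).symm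
    rw [Finset.mem_filter, not_and] at hxA
    have := hxA hx
    omega
  have h₂ : ∑ x ∈ A, (numHeavy G S t x - 2) + A.card * 2 = ∑ x ∈ A, numHeavy G S t x := by
    rw [← smul_eq_mul, ← Finset.sum_const, ← Finset.sum_add_distrib]
    refine Finset.sum_congr rfl fun x hx => Nat.sub_add_cancel ?_
    simp only [hA, Finset.mem_filter] at hx
    exact hx.2
  have h₃ : ∑ x ∈ A, numHeavy G S t x ≤ 2 * (A.card + B.card) := sum_card_neighbors_le hG hAB
  omega

/-- A vertex of small degree in a planar graph most of whose neighbours have small degree. -/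
theorem exists_light_vertex (hG : IsPlanar G) (hS : S.Nonempty) :
    ∃ x ∈ S, ∑ t ∈ Finset.Icc 7 12, (numHeavy G S t x - 2) < 2 * (6 - degIn G S x) := by
  by_contra! hcon
  have h₁ := degSum_add_six_le hG.1 hS
  have h₂ : ∑ x ∈ S.filter (fun x => degIn G S x < 6), 2 * (6 - degIn G S x) ≤
      ∑ t ∈ Finset.Icc 7 12, 2 * (S.filter fun y => t ≤ degIn G S y).card := by
    refine (Finset.sum_le_sum fun x hx => hcon x (Finset.mem_filter.1 hx).1).trans ?_
    rw [Finset.sum_comm]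
    refine Finset.sum_le_sum fun t ht => sum_numHeavy_sub_two_le hG.2 ?_
    rw [Finset.mem_Icc] at ht
    omega
  have h₃ : ∑ x ∈ S.filter (fun x => degIn G S x < 6), 2 * (6 - degIn G S x) =
      2 * ∑ x ∈ S, (6 - degIn G S x) := by
    rw [Finset.mul_sum]
    refine Finset.sum_subset (Finset.filter_subset _ _) fun x hx hxA => ?_
    simp only [Finset.mem_filter, not_and] at hxA
    have := hxA hx
    omega
  have h₄ : ∑ t ∈ Finset.Icc 7 12, (S.filter fun y => t ≤ degIn G S y).card ≤
      ∑ y ∈ S, (degIn G S y - 6) := by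
    have := Finset.sum_card_bipartiteAbove_eq_sum_card_bipartiteBelow
      (s := Finset.Icc 7 12) (t := S) fun t y => t ≤ degIn G S y
    refine this.trans_le (Finset.sum_le_sum fun y _ => ?_)
    refine (Finset.card_le_card (t := Finset.Icc 7 (degIn G S y)) fun t ht => ?_).trans
      (by simp)
    simp only [Finset.bipartiteBelow, Finset.mem_filter, Finset.mem_Icc] at ht ⊢
    omega
  rw [h₃, ← Finset.mul_sum] at h₂
  have h₅ : degSum G S + ∑ x ∈ S, (6 - degIn G S x) =
      6 * S.card + ∑ y ∈ S, (degIn G S y - 6) := by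
    rw [degSum, ← Finset.sum_add_distrib, mul_comm, ← smul_eq_mul, ← Finset.sum_const,
      ← Finset.sum_add_distrib]
    exact Finset.sum_congr rfl fun x _ => by omega
  omega

end LightVertex

section Combination

open scoped Classical

variable {G : SimpleGraph V} {Δ : ℕ}

theorem IsPlanar.mono {H : SimpleGraph V} (hG : IsPlanar G) (hle : H ≤ G) : IsPlanar H :=
  ⟨fun h => hG.1 (h.mono hle), fun h => hG.2 (h.mono hle)⟩

theorem sum_min_sub_six_le {S : Finset V} {x z₁ z₂ : V} {R : Finset V} (h₁₂ : z₁ ≠ z₂)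
    (hz₁ : z₁ ∉ R) (hz₂ : z₂ ∉ R) (hR : S.filter (G.Adj x) = insert z₁ (insert z₂ R))
    (hle₁ : ∀ y ∈ R, degIn G S y ≤ degIn G S z₁) (hle₂ : ∀ y ∈ R, degIn G S y ≤ degIn G S z₂) :
    ∑ y ∈ R, (min (degIn G S y) 12 - 6) ≤ ∑ t ∈ Finset.Icc 7 12, (numHeavy G S t x - 2) := by
  have h₁ : ∀ t, (R.filter fun y => t ≤ degIn G S y).card ≤ numHeavy G S t x - 2 := by
    intro t
    rcases (R.filter fun y => t ≤ degIn G S y).eq_empty_or_nonempty with h | ⟨y, hy⟩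
    · simp [h]
    · rw [Finset.mem_filter] at hy
      have ht₁ := hy.2.trans (hle₁ y hy.1)
      have ht₂ := hy.2.trans (hle₂ y hy.1)
      rw [numHeavy, Finset.filter_comm, hR,
        Finset.filter_insert, if_pos ht₁, Finset.filter_insert, if_pos ht₂,
        Finset.card_insert_of_notMem (by simp [h₁₂, hz₁]),
        Finset.card_insert_of_notMem (by simp [hz₂])]
      omega
  calc ∑ y ∈ R, (min (degIn G S y) 12 - 6)
      = ∑ y ∈ R, ((Finset.Icc 7 12).filter fun t => t ≤ degIn G S y).card := by
        refine Finset.sum_congr rfl fun y _ => ?_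
        rw [show ((Finset.Icc 7 12).filter fun t => t ≤ degIn G S y) =
          Finset.Icc 7 (min (degIn G S y) 12) by
            ext t; simp only [Finset.mem_filter, Finset.mem_Icc]; omega, Nat.card_Icc]
        omega
    _ = ∑ t ∈ Finset.Icc 7 12, (R.filter fun y => t ≤ degIn G S y).card :=
        (Finset.sum_card_bipartiteAbove_eq_sum_card_bipartiteBelow
          (s := Finset.Icc 7 12) (t := R) fun t y => t ≤ degIn G S y).symm
    _ ≤ _ := Finset.sum_le_sum fun t _ => h₁ t

theorem exists_two_largest {α : Type*} (T : Finset α) (f : α → ℕ) (hT : 2 ≤ T.card) :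
    ∃ z₁ z₂ : α, ∃ R : Finset α, z₁ ≠ z₂ ∧ z₁ ∉ R ∧ z₂ ∉ R ∧ T = insert z₁ (insert z₂ R) ∧
      (∀ y ∈ R, f y ≤ f z₁) ∧ ∀ y ∈ R, f y ≤ f z₂ := by
  obtain ⟨z₁, hz₁, h₁⟩ := T.exists_max_image f (Finset.card_pos.1 (by omega))
  have hc := Finset.card_erase_add_one hz₁
  obtain ⟨z₂, hz₂, h₂⟩ := (T.erase z₁).exists_max_image f (Finset.card_pos.1 (by omega))
  refine ⟨z₁, z₂, (T.erase z₁).erase z₂, (Finset.ne_of_mem_erase hz₂).symm, by simp, by simp,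
    by rw [Finset.insert_erase hz₂, Finset.insert_erase hz₁], fun y hy => h₁ y ?_,
    fun y hy => h₂ y (Finset.mem_of_mem_erase hy)⟩
  exact Finset.mem_of_mem_erase (Finset.mem_of_mem_erase hy)

variable [Fintype V]

namespace AcyclicallyEdgeCritical

theorem exists_adj {k : ℕ} (hG : AcyclicallyEdgeCritical G (k + 1)) : ∃ a b, G.Adj a b := by
  by_contra! hcon
  refine hG.1 ⟨fun _ => 0, fun e he => ?_, fun v w hw => ?_⟩
  · induction e with
    | _ a b => exact absurd he (hcon a b)
  · cases w with
    | nil => exact absurd hw (by simp)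
    | cons h _ => exact absurd h (hcon _ _)

theorem two_le_degree (hG : AcyclicallyEdgeCritical G (Δ + 10)) (hΔ : ∀ v, G.degree v ≤ Δ)
    {x y : V} (hxy : G.Adj x y) : 2 ≤ G.degree x := by
  by_contra! hcon
  have h₁ : 0 < G.degree x := (G.degree_pos_iff_exists_adj x).2 ⟨y, hxy⟩
  obtain ⟨z, hz⟩ := Finset.card_eq_one.1 (show (G.neighborFinset x).card = 1 by
    rw [card_neighborFinset_eq_degree]; omega)
  refine hG.neighborSet_ne_singleton hΔ x z ?_
  rw [← coe_neighborFinset, hz, Finset.coe_singleton]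

theorem rich_of_adj_of_degree_eq_two (hG : AcyclicallyEdgeCritical G (Δ + 10))
    (hΔ : ∀ v, G.degree v ≤ Δ) {v x : V} (hvx : G.Adj v x) (hx : G.degree x = 2) :
    11 ≤ ((G.neighborFinset v).filter fun u => u ≠ x ∧ 12 ≤ G.degree u).card := by
  rw [← card_neighborFinset_eq_degree] at hx
  have hv : v ∈ G.neighborFinset x := by simpa using hvx.symm
  obtain ⟨z₁, z₂, h₁₂, hN⟩ := Finset.card_eq_two.1 hx
  have hN' : G.neighborSet x = {z₁, z₂} := by rw [← coe_neighborFinset, hN]; simp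
  rw [hN, Finset.mem_insert, Finset.mem_singleton] at hv
  rcases hv with rfl | rfl
  · exact hG.rich_of_neighborSet_eq_pair hΔ h₁₂ hN'
  · exact hG.rich_of_neighborSet_eq_pair hΔ h₁₂.symm (hN'.trans (Set.pair_comm _ _))

/-- A vertex with a neighbour of degree two has many neighbours of degree at least three, and
all of these have large degree if there are at most eleven of them. -/
theorem eleven_le_degIn (hG : AcyclicallyEdgeCritical G (Δ + 10)) (hΔ : ∀ v, G.degree v ≤ Δ)
    {S : Finset V} (hS : ∀ v, v ∈ S ↔ 3 ≤ G.degree v) {v x : V} (hvx : G.Adj v x)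
    (hx : G.degree x = 2) :
    11 ≤ degIn G S v ∧ (degIn G S v ≤ 11 → ∀ u ∈ S, G.Adj v u → 12 ≤ G.degree u) := by
  have h₁ := hG.rich_of_adj_of_degree_eq_two hΔ hvx hx
  have h₂ : ((G.neighborFinset v).filter fun u => u ≠ x ∧ 12 ≤ G.degree u) ⊆
      S.filter (G.Adj v) := fun u hu => by
    rw [Finset.mem_filter, mem_neighborFinset] at hu
    rw [Finset.mem_filter, hS]
    exact ⟨by omega, hu.1⟩
  refine ⟨h₁.trans (Finset.card_le_card h₂), fun hle u hu hvu => ?_⟩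
  have h₃ : u ∈ S.filter (G.Adj v) := Finset.mem_filter.2 ⟨hu, hvu⟩
  rw [← Finset.eq_of_subset_of_card_le h₂ (hle.trans h₁), Finset.mem_filter] at h₃
  exact h₃.2.2

theorem degree_eq_degIn (hG : AcyclicallyEdgeCritical G (Δ + 10)) (hΔ : ∀ v, G.degree v ≤ Δ)
    {S : Finset V} (hS : ∀ v, v ∈ S ↔ 3 ≤ G.degree v) {v : V}
    (hv : ∀ x, G.Adj v x → G.degree x ≠ 2) : G.neighborFinset v = S.filter (G.Adj v) := by
  ext u
  rw [mem_neighborFinset, Finset.mem_filter, hS]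
  refine ⟨fun h => ⟨?_, h⟩, And.right⟩
  have := hG.two_le_degree hΔ h.symm
  have := hv u h
  omega

/-- An acyclically edge critical graph of maximum degree at most `Δ` for `Δ + 10` colours is not
planar. -/
theorem not_isPlanar (hG : AcyclicallyEdgeCritical G (Δ + 10)) (hΔ : ∀ v, G.degree v ≤ Δ) :
    ¬ IsPlanar G := by
  intro hP
  obtain ⟨S, hS⟩ : ∃ S : Finset V, ∀ v, v ∈ S ↔ 3 ≤ G.degree v :=
    ⟨Finset.univ.filter fun v => 3 ≤ G.degree v, by simp⟩
  have hSne : S.Nonempty := by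
    obtain ⟨a, b, hab⟩ := hG.exists_adj
    by_cases ha : 3 ≤ G.degree a
    · exact ⟨a, (hS a).2 ha⟩
    · have h₁ := (hG.eleven_le_degIn hΔ hS hab.symm
        (le_antisymm (by omega) (hG.two_le_degree hΔ hab))).1
      obtain ⟨u, hu⟩ := Finset.card_pos.1 (show 0 < degIn G S b by omega)
      exact ⟨u, Finset.mem_of_mem_filter u hu⟩
  obtain ⟨x, hxS, hx⟩ := exists_light_vertex hP hSne
  have hN : G.neighborFinset x = S.filter (G.Adj x) :=
    hG.degree_eq_degIn hΔ hS fun y hxy hy => by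
      have := (hG.eleven_le_degIn hΔ hS hxy hy).1
      omega
  have hd : G.degree x = degIn G S x := by rw [← card_neighborFinset_eq_degree, hN, degIn]
  have h3 := (hS x).1 hxS
  have hlow : ∀ y, G.Adj x y → degIn G S y ≤ 11 → G.degree y = degIn G S y := by
    intro y hxy hy
    rw [← card_neighborFinset_eq_degree, hG.degree_eq_degIn hΔ hS fun u hyu hu => ?_, degIn]
    have := (hG.eleven_le_degIn hΔ hS hyu hu).2 hy x hxS hxy.symm
    omega
  obtain ⟨z₁, z₂, R, h₁₂, hz₁, hz₂, hT, hle₁, hle₂⟩ :=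
    exists_two_largest (S.filter (G.Adj x)) (degIn G S) (by
      rw [← hN, card_neighborFinset_eq_degree]; omega)
  have hsum := (sum_min_sub_six_le h₁₂ hz₁ hz₂ hT hle₁ hle₂).trans_lt hx
  have hadj : ∀ y ∈ R, G.Adj x y := fun y hy => by
    have : y ∈ S.filter (G.Adj x) := by rw [hT]; simp [hy]
    exact (Finset.mem_filter.1 this).2
  have hcard : degIn G S x = R.card + 2 := by
    rw [degIn, hT, Finset.card_insert_of_notMem (by simp [h₁₂, hz₁]),
      Finset.card_insert_of_notMem hz₂]
  have hset : G.neighborSet x = insert z₁ (insert z₂ (R : Set V)) := by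
    rw [← coe_neighborFinset, hN, hT]; simp
  have hR : R.card = 1 ∨ R.card = 2 ∨ R.card = 3 := by omega
  rcases hR with hR | hR | hR
  · obtain ⟨y, rfl⟩ := Finset.card_eq_one.1 hR
    simp only [Finset.sum_singleton, Finset.mem_singleton, Finset.coe_singleton,
      forall_eq] at *
    have := hlow y hadj (by omega)
    exact hG.neighborSet_ne_three hΔ (h3.trans (hΔ x)) (by simp [h₁₂, hz₁, hz₂]) (by omega) hset
  · obtain ⟨y₁, y₂, hy, rfl⟩ := Finset.card_eq_two.1 hR
    rw [Finset.sum_pair hy] at hsum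
    simp only [Finset.mem_insert, Finset.mem_singleton, Finset.coe_insert, Finset.coe_singleton,
      forall_eq_or_imp, forall_eq, not_or] at *
    have := hlow y₁ hadj.1 (by omega)
    have := hlow y₂ hadj.2 (by omega)
    exact hG.neighborSet_ne_four hΔ (by simp [h₁₂, hz₁, hz₂, hy]) (by omega) (by omega)
      (by omega) hset
  · obtain ⟨y₁, y₂, y₃, hy₁₂, hy₁₃, hy₂₃, rfl⟩ := Finset.card_eq_three.1 hR
    rw [Finset.sum_insert (by simp [hy₁₂, hy₁₃]), Finset.sum_pair hy₂₃] at hsum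
    simp only [Finset.mem_insert, Finset.mem_singleton, Finset.coe_insert, Finset.coe_singleton,
      forall_eq_or_imp, forall_eq, not_or] at *
    have := hlow y₁ hadj.1 (by omega)
    have := hlow y₂ hadj.2.1 (by omega)
    have := hlow y₃ hadj.2.2 (by omega)
    by_cases h₁ : G.degree y₁ ≤ 6
    · by_cases h₂ : G.degree y₂ ≤ 6
      · exact hG.neighborSet_ne_five hΔ (by simp [h₁₂, hz₁, hz₂, hy₁₂, hy₁₃, hy₂₃]) h₁ h₂
          (by omega) hset
      · rw [Set.pair_comm y₂ y₃] at hset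
        exact hG.neighborSet_ne_five hΔ
          (by simp [h₁₂, hz₁, hz₂, hy₁₂, hy₁₃, hy₂₃.symm]) h₁ (by omega) (by omega) hset
    · rw [Set.insert_comm y₁ y₂, Set.pair_comm y₁ y₃] at hset
      exact hG.neighborSet_ne_five hΔ
        (by simp [h₁₂, hz₁, hz₂, hy₁₂.symm, hy₁₃.symm, hy₂₃]) (by omega) (by omega)
        (by omega) hset

end AcyclicallyEdgeCritical

theorem exists_acyclicallyEdgeCritical_le {k : ℕ} (hG : ¬ HasAEC G k) :
    ∃ H ≤ G, AcyclicallyEdgeCritical H k := by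
  obtain ⟨H, hle, hH⟩ := (Set.toFinite {H : SimpleGraph V | ¬ HasAEC H k}).exists_le_minimal hG
  exact ⟨H, hle, hH.prop, fun K hK hne => by_contra fun h => hne (hH.eq_of_le h hK)⟩

end Combination

/-- Every planar graph `G` has an acyclic edge coloring with `Δ(G) + 10` colors. -/
theorem planar_acyclic_chromatic_index_le_maxDegree_add_ten
    {V : Type u} [Fintype V] (G : SimpleGraph V) [DecidableRel G.Adj]
    (hG : IsPlanar G) : HasAEC G (G.maxDegree + 10) := by
  classical
  by_contra hcon
  obtain ⟨H, hle, hH⟩ := exists_acyclicallyEdgeCritical_le hcon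
  refine hH.not_isPlanar (fun v => ?_) (hG.mono hle)
  refine le_trans ?_ (G.degree_le_maxDegree v)
  rw [← card_neighborFinset_eq_degree, ← card_neighborFinset_eq_degree]
  refine Finset.card_le_card fun u hu => ?_
  rw [mem_neighborFinset] at hu ⊢
  exact hle hu
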